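/- arXiv:math/0205047 — 2 statements merged into one kernel-verified Lean document; each statement's English description precedes it below -/
import Mathlib

section
/- Let G be a loopless finite graph and let b be the number of blocks of G that are not isolated vertices. Then the chromatic polynomial P(G,t) has a zero of multiplicity exactly b at t = 1. -/
open Polynomial

/-- A finite multigraph (loops and multiple edges allowed), given with a fixed
orientation of its edges: each edge `e` has a source `src e` and target `tgt e`. -/
structure Multigraph where
  V : Type
  E : Type
  [fintypeV : Fintype V]
  [fintypeE : Fintype E]
  [decEqV : DecidableEq V]
  [decEqE : DecidableEq E]
  src : E → V
  tgt : E → V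

attribute [instance] Multigraph.fintypeV Multigraph.fintypeE Multigraph.decEqV Multigraph.decEqE

namespace Multigraph

/-- The number of proper `t`-colourings of `G`. -/
noncomputable def properColorings (G : Multigraph) (t : ℕ) : ℕ :=
  Nat.card {f : G.V → Fin t // ∀ e : G.E, f (G.src e) ≠ f (G.tgt e)}

/-- `P` is the chromatic polynomial of `G`: its value at each positive integer `t`
is the number of proper `t`-colourings of `G`. -/
def IsChromaticPoly (G : Multigraph) (P : Polynomial ℝ) : Prop :=
  ∀ t : ℕ, 0 < t → P.eval (t : ℝ) = G.properColorings t

/-- `G` has no loops. -/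
def Loopless (G : Multigraph) : Prop := ∀ e : G.E, G.src e ≠ G.tgt e

/-- Deletion of the edge `e₀`. -/
def deleteEdge (G : Multigraph) (e₀ : G.E) : Multigraph where
  V := G.V
  E := {e : G.E // e ≠ e₀}
  src e := G.src e.1
  tgt e := G.tgt e.1

/-- Contraction of the edge `e₀`: its two endpoints are identified (the vertex
`src e₀` is merged into `tgt e₀`), and `e₀` is removed. -/
def contractEdge (G : Multigraph) (e₀ : G.E) : Multigraph where
  V := {v : G.V // v = G.src e₀ → v = G.tgt e₀}
  E := {e : G.E // e ≠ e₀}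
  src e := if h : G.src e.1 = G.src e₀ then ⟨G.tgt e₀, fun _ => rfl⟩
    else ⟨G.src e.1, fun hv => absurd hv h⟩
  tgt e := if h : G.tgt e.1 = G.src e₀ then ⟨G.tgt e₀, fun _ => rfl⟩
    else ⟨G.tgt e.1, fun hv => absurd hv h⟩

/-- Two vertices are connected by a walk using only edges in `A`. -/
def ReachOn (G : Multigraph) (A : Finset G.E) (a b : G.V) : Prop :=
  Relation.EqvGen (fun x y => ∃ e ∈ A, G.src e = x ∧ G.tgt e = y) a b

/-- The number of connected components of the spanning subgraph of `G`
with edge set `A`. -/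
noncomputable def numComponentsOn (G : Multigraph) (A : Finset G.E) : ℕ :=
  Nat.card (Quotient (Relation.EqvGen.setoid (fun x y => ∃ e ∈ A, G.src e = x ∧ G.tgt e = y)))

/-- The number of connected components of `G`. -/
noncomputable def numComponents (G : Multigraph) : ℕ := G.numComponentsOn Finset.univ

/-- `G` is connected. -/
def Conn (G : Multigraph) : Prop :=
  Nonempty G.V ∧ ∀ a b : G.V, G.ReachOn Finset.univ a b

/-- `e` is a bridge of `G`. -/
def IsBridge (G : Multigraph) (e : G.E) : Prop :=
  G.numComponents < (G.deleteEdge e).numComponents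

/-- A nowhere-zero `ZMod t`-flow on `G` (with respect to the fixed orientation). -/
def IsNZFlow (G : Multigraph) {t : ℕ} (f : G.E → ZMod t) : Prop :=
  (∀ e : G.E, f e ≠ 0) ∧
    ∀ v : G.V, (∑ e : G.E, if G.src e = v then f e else 0) =
      ∑ e : G.E, if G.tgt e = v then f e else 0

/-- The number of nowhere-zero `ZMod t`-flows of `G`. -/
noncomputable def numFlows (G : Multigraph) (t : ℕ) : ℕ :=
  Nat.card {f : G.E → ZMod t // G.IsNZFlow f}

/-- `F` is the flow polynomial of `G`: its value at each positive integer `t`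
is the number of nowhere-zero `ZMod t`-flows of `G`. -/
def IsFlowPoly (G : Multigraph) (F : Polynomial ℝ) : Prop :=
  ∀ t : ℕ, 0 < t → F.eval (t : ℝ) = G.numFlows t

end Multigraph

namespace Multigraph

variable {G : Multigraph}

/-- A subgraph of a multigraph: a set of vertices and a set of edges whose
endpoints lie among those vertices. -/
structure Subgr (G : Multigraph) where
  verts : Set G.V
  edges : Set G.E
  src_mem : ∀ e ∈ edges, G.src e ∈ verts
  tgt_mem : ∀ e ∈ edges, G.tgt e ∈ verts

/-- Reachability inside a subgraph (using only its edges). -/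
def Subgr.ReachIn (H : Subgr G) (a b : G.V) : Prop :=
  Relation.EqvGen (fun x y => ∃ e ∈ H.edges, G.src e = x ∧ G.tgt e = y) a b

/-- A subgraph is connected if it is nonempty and any two of its vertices are
joined by a walk inside it. -/
def Subgr.ConnIn (H : Subgr G) : Prop :=
  H.verts.Nonempty ∧ ∀ a ∈ H.verts, ∀ b ∈ H.verts, H.ReachIn a b

/-- Deleting a vertex from a subgraph (together with all incident edges). -/
def Subgr.deleteVert (H : Subgr G) (v : G.V) : Subgr G where
  verts := H.verts \ {v}
  edges := {e ∈ H.edges | G.src e ≠ v ∧ G.tgt e ≠ v}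
  src_mem := fun e he => ⟨H.src_mem e he.1, he.2.1⟩
  tgt_mem := fun e he => ⟨H.tgt_mem e he.1, he.2.2⟩

/-- A subgraph `H` is non-separable if it is connected and `H - v` is connected
(or empty) for every vertex `v` of `H`. -/
def Subgr.Nonseparable (H : Subgr G) : Prop :=
  H.ConnIn ∧ ∀ v ∈ H.verts, (H.deleteVert v).verts = ∅ ∨ (H.deleteVert v).ConnIn

/-- A block of `G` is a maximal non-separable subgraph. -/
def Subgr.IsBlock (H : Subgr G) : Prop :=
  H.Nonseparable ∧ ∀ K : Subgr G, K.Nonseparable → H.verts ⊆ K.verts →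
    H.edges ⊆ K.edges → (K.verts = H.verts ∧ K.edges = H.edges)

/-- The number of blocks of `G` which are not isolated vertices
(i.e. which contain at least one edge). -/
noncomputable def numEdgeBlocks (G : Multigraph) : ℕ :=
  Nat.card {H : Subgr G // H.IsBlock ∧ H.edges.Nonempty}

end Multigraph

/-- A natural-valued matroid rank function on finite sets. -/
structure IsRankFun {α : Type*} [DecidableEq α] (r : Finset α → ℕ) : Prop where
  empty : r ∅ = 0
  mono : ∀ {A B : Finset α}, A ⊆ B → r A ≤ r B
  insert_le : ∀ e A, r (insert e A) ≤ r A + 1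
  submod : ∀ A B, r (A ∪ B) + r (A ∩ B) ≤ r A + r B

namespace IsRankFun

variable {α : Type*} [DecidableEq α] {r : Finset α → ℕ}

/-- Contraction of a rank function by one element. -/
def contract (r : Finset α → ℕ) (e : α) (A : Finset α) : ℕ := r (insert e A) - r {e}

/-- A set is irreducible for `r` if `r` does not split additively over a proper bipartition. -/
def Irred (r : Finset α → ℕ) (E : Finset α) : Prop :=
  ∀ S ⊆ E, r S + r (E \ S) = r E → S = ∅ ∨ S = E

/-- The alternating sum of ranks over all subsets, whose absolute value is Crapo's beta
invariant. -/
def alternatingSum (r : Finset α → ℕ) (E : Finset α) : ℤ :=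
  ∑ A ∈ E.powerset, (-1) ^ A.card * (r A : ℤ)

theorem contract_add (hr : IsRankFun r) (e : α) (A : Finset α) :
    contract r e A + r {e} = r (insert e A) :=
  Nat.sub_add_cancel (hr.mono (by simp))

theorem isRankFun_contract (hr : IsRankFun r) (e : α) : IsRankFun (contract r e) where
  empty := by simp [contract]
  mono h := Nat.sub_le_sub_right (hr.mono (Finset.insert_subset_insert e h)) _
  insert_le f A := by
    have h₁ := hr.contract_add e A
    have h₂ := hr.contract_add e (insert f A)
    have h₃ := hr.insert_le f (insert e A)
    rw [Finset.insert_comm] at h₃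
    omega
  submod A B := by
    have h₁ := hr.contract_add e A
    have h₂ := hr.contract_add e B
    have h₃ := hr.contract_add e (A ∪ B)
    have h₄ := hr.contract_add e (A ∩ B)
    have h₅ := hr.submod (insert e A) (insert e B)
    rw [← Finset.insert_union_distrib, ← Finset.insert_inter_distrib] at h₅
    omega

theorem singleton_le_one (hr : IsRankFun r) (e : α) : r {e} ≤ 1 := by
  have := hr.insert_le e ∅
  rw [hr.empty] at this
  simpa using this

theorem insert_le_add_singleton (hr : IsRankFun r) (e : α) (A : Finset α) :
    r (insert e A) ≤ r A + r {e} := by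
  have := hr.submod A {e}
  rw [Finset.union_singleton] at this
  omega

theorem alternatingSum_insert (r : Finset α → ℕ) {e : α} {E : Finset α} (he : e ∉ E) :
    alternatingSum r (insert e E) =
      alternatingSum r E - ∑ A ∈ E.powerset, (-1) ^ A.card * (r (insert e A) : ℤ) := by
  rw [alternatingSum, Finset.sum_powerset_insert he, alternatingSum, sub_eq_add_neg,
    ← Finset.sum_neg_distrib]
  congr 1
  refine Finset.sum_congr rfl fun A hA => ?_
  rw [Finset.card_insert_of_notMem fun h => he (Finset.mem_powerset.1 hA h)]
  ring

theorem alternatingSum_insert_contract (hr : IsRankFun r) {e : α} {E : Finset α} (he : e ∉ E)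
    (hE : E.Nonempty) :
    alternatingSum r (insert e E) = alternatingSum r E - alternatingSum (contract r e) E := by
  rw [alternatingSum_insert r he]
  congr 1
  have : ∀ A, (r (insert e A) : ℤ) = contract r e A + r {e} := fun A => by
    rw [← hr.contract_add e A]; push_cast; rfl
  simp only [this, mul_add, Finset.sum_add_distrib, ← Finset.sum_mul, 
    Finset.sum_powerset_neg_one_pow_card_of_nonempty hE,
    zero_mul, add_zero, alternatingSum]

theorem alternatingSum_singleton (hr : IsRankFun r) (e : α) :
    alternatingSum r {e} = -r {e} := by
  have := alternatingSum_insert r (Finset.notMem_empty e)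
  simpa [alternatingSum, hr.empty] using this

theorem alternatingSum_insert_of_rank_eq_add (hr : IsRankFun r) {e : α} {E : Finset α}
    (he : e ∉ E) (hE : E.Nonempty) (h : r (insert e E) = r E + r {e}) :
    alternatingSum r (insert e E) = 0 := by
  rw [hr.alternatingSum_insert_contract he hE, sub_eq_zero]
  refine Finset.sum_congr rfl fun A hA => ?_
  rw [Finset.mem_powerset] at hA
  have h₁ := hr.contract_add e A
  have h₂ := hr.insert_le_add_singleton e A
  have h₃ := hr.submod E (insert e A)
  rw [Finset.union_insert, Finset.union_eq_left.2 hA, Finset.inter_insert_of_notMem he,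
    Finset.inter_eq_right.2 hA] at h₃
  congr 2
  omega

theorem beta_insert (hr : IsRankFun r) {e : α} {E : Finset α} (he : e ∉ E) (hE : E.Nonempty)
    (h₁ : r {e} = 1) (h : r (insert e E) = r E) :
    (-1) ^ r (insert e E) * alternatingSum r (insert e E) =
      (-1) ^ r E * alternatingSum r E +
        (-1) ^ contract r e E * alternatingSum (contract r e) E := by
  have h₂ := hr.contract_add e E
  rw [hr.alternatingSum_insert_contract he hE, h, show r E = contract r e E + 1 by omega]
  ring

theorem beta_nonneg (hr : IsRankFun r) (E : Finset α) :
    0 ≤ (-1) ^ r E * alternatingSum r E := by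
  induction E using Finset.induction generalizing r with
  | empty => simp [alternatingSum, hr.empty]
  | insert e E he ih =>
    obtain rfl | hE := E.eq_empty_or_nonempty
    · have := hr.singleton_le_one e
      rw [insert_empty_eq, hr.alternatingSum_singleton e]
      interval_cases r {e} <;> simp
    · by_cases h : r (insert e E) = r E + r {e}
      · rw [hr.alternatingSum_insert_of_rank_eq_add he hE h, mul_zero]
      · have h₁ := hr.singleton_le_one e
        have h₂ := hr.insert_le_add_singleton e E
        have h₃ := hr.mono (Finset.subset_insert e E)
        rw [hr.beta_insert he hE (by omega) (by omega)]
        exact add_nonneg (ih hr) (ih (hr.isRankFun_contract e))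

theorem Irred.uncross {E A B : Finset α} {e : α} (hr : IsRankFun r)
    (hE : Irred r (insert e E)) (he : e ∉ E)
    (h₁ : r {e} = 1) (h : r (insert e E) = r E)
    (hA : A ⊆ E) (hB : B ⊆ E) (hrA : r A + r (E \ A) = r E)
    (hrB : contract r e B + contract r e (E \ B) = contract r e E) :
    A ∩ B = ∅ ∨ (E \ A) ∩ (E \ B) = ∅ := by
  have c₁ := hr.contract_add e B
  have c₂ := hr.contract_add e (E \ B)
  have c₃ := hr.contract_add e E
  have s₁ := hr.submod A (insert e B)
  have s₂ := hr.submod (E \ A) (insert e (E \ B))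
  have i₁ : A ∩ insert e B = A ∩ B := by grind
  have i₂ : (E \ A) ∩ insert e (E \ B) = (E \ A) ∩ (E \ B) := by grind
  have d₁ : insert e E \ (A ∩ B) = (E \ A) ∪ insert e (E \ B) := by grind
  have d₂ : insert e E \ ((E \ A) ∩ (E \ B)) = A ∪ insert e B := by grind
  rw [i₁] at s₁
  rw [i₂] at s₂
  have ne : ∀ S ⊆ E, S ≠ insert e E := fun S hS h' =>
    he (hS (h' ▸ Finset.mem_insert_self e E))
  have m₁ := hr.submod (A ∩ B) (insert e E \ (A ∩ B))
  have m₂ := hr.submod ((E \ A) ∩ (E \ B)) (insert e E \ ((E \ A) ∩ (E \ B)))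
  rw [Finset.union_sdiff_of_subset (by grind), Finset.inter_sdiff_self, hr.empty] at m₁ m₂
  by_cases hc : r (A ∩ B) + r (insert e E \ (A ∩ B)) = r (insert e E)
  · exact (hE _ (by grind) hc).imp_right fun h' => absurd h' (ne _ (by grind))
  · refine Or.inr ((hE ((E \ A) ∩ (E \ B)) (by grind) ?_).resolve_right
      (ne _ (by grind)))
    rw [d₂] at m₂ ⊢
    rw [d₁] at m₁ hc
    omega

theorem Irred.delete_or_contract {E : Finset α} {e : α} (hr : IsRankFun r)
    (hE : Irred r (insert e E)) (he : e ∉ E) (h₁ : r {e} = 1) (h : r (insert e E) = r E) :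
    Irred r E ∨ Irred (contract r e) E := by
  by_contra! hcon
  simp only [Irred, not_forall, not_or] at hcon
  obtain ⟨⟨A, hA, hrA, hA₀, hA₁⟩, B, hB, hrB, hB₀, hB₁⟩ := hcon
  have u₁ := hE.uncross hr he h₁ h hA hB hrA hrB
  have u₂ := hE.uncross hr he h₁ h hA (B := E \ B) Finset.sdiff_subset hrA
    (by rw [Finset.sdiff_sdiff_eq_self hB, add_comm, hrB])
  rw [Finset.sdiff_sdiff_eq_self hB] at u₂
  simp only [Finset.ext_iff, Finset.mem_inter, Finset.mem_sdiff, Finset.notMem_empty] at *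
  grind

theorem Irred.beta_pos (hr : IsRankFun r) {E : Finset α} (hE : Irred r E) (h₀ : r E ≠ 0) :
    0 < (-1) ^ r E * alternatingSum r E := by
  induction E using Finset.induction generalizing r with
  | empty => exact absurd hr.empty h₀
  | insert e E he ih =>
    obtain rfl | hne := E.eq_empty_or_nonempty
    · have := hr.singleton_le_one e
      rw [insert_empty_eq] at h₀
      rw [insert_empty_eq, hr.alternatingSum_singleton e, show r {e} = 1 by omega]
      simp
    · have split : ∀ f ∈ insert e E, r {f} + r (insert e E \ {f}) ≠ r (insert e E) := by
        intro f hf h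
        obtain ⟨x, hx⟩ := hne
        rcases hE {f} (by simpa using hf) h with h' | h'
        · simp at h'
        · have hx' : x ∈ ({f} : Finset α) := h' ▸ Finset.mem_insert_of_mem hx
          have he' : e ∈ ({f} : Finset α) := h' ▸ Finset.mem_insert_self e E
          rw [Finset.mem_singleton] at hx' he'
          exact he (by rw [he', ← hx']; exact hx)
      have hloop : ∀ f ∈ insert e E, r {f} = 1 := by
        intro f hf
        have h₁ := hr.singleton_le_one f
        have h₂ := hr.insert_le_add_singleton f (insert e E \ {f})
        have h₃ := hr.mono (Finset.sdiff_subset (s := insert e E) (t := {f}))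
        have h₄ := split f hf
        rw [show insert f (insert e E \ {f}) = insert e E by grind] at h₂
        omega
      have h₁ := hloop e (Finset.mem_insert_self e E)
      have h₂ := hr.insert_le_add_singleton e E
      have h₃ := hr.mono (Finset.subset_insert e E)
      have h₄ := split e (Finset.mem_insert_self e E)
      rw [show insert e E \ {e} = E by grind] at h₄
      have h : r (insert e E) = r E := by omega
      rw [hr.beta_insert he hne h₁ h]
      by_cases hdel : Irred r E
      · exact add_pos_of_pos_of_nonneg (ih hr hdel (by omega))
          ((hr.isRankFun_contract e).beta_nonneg E)
      · refine add_pos_of_nonneg_of_pos (hr.beta_nonneg E) (ih (hr.isRankFun_contract e)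
          ((hE.delete_or_contract hr he h₁ h).resolve_left hdel) fun hc => hdel ?_)
        have h₅ := hr.contract_add e E
        have pos : ∀ T ⊆ E, T.Nonempty → 1 ≤ r T := by
          rintro T hT ⟨x, hx⟩
          rw [← hloop x (Finset.mem_insert_of_mem (hT hx))]
          exact hr.mono (by simpa using hx)
        intro S hS hrS
        by_contra! hcon
        have p₁ := pos S hS hcon.1
        have p₂ := pos (E \ S) Finset.sdiff_subset
          (Finset.sdiff_nonempty.2 fun h' => hcon.2 (hS.antisymm h'))
        omega

end IsRankFun

namespace IsRankFun

variable {α : Type*} [DecidableEq α] {r : Finset α → ℕ}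

/-- The maximal nonempty irreducible subsets of `E`. -/
def components (r : Finset α → ℕ) (E : Finset α) : Set (Finset α) :=
  {C | Maximal (fun C => C ⊆ E ∧ C.Nonempty ∧ Irred r C) C}

theorem mem_components {E C : Finset α} :
    C ∈ components r E ↔ Maximal (fun C => C ⊆ E ∧ C.Nonempty ∧ Irred r C) C :=
  Iff.rfl

/-- The characteristic polynomial of the restriction of `r` to `E`, scaled by a power of the
variable so that its degree is `n`. -/
noncomputable def charPoly (r : Finset α → ℕ) (n : ℕ) (E : Finset α) : ℝ[X] :=
  ∑ A ∈ E.powerset, (-1) ^ A.card * X ^ (n - r A)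

theorem eq_add_of_separator (hr : IsRankFun r) {E S A : Finset α} (hS : S ⊆ E)
    (h : r S + r (E \ S) = r E) (hA : A ⊆ E) : r A = r (A ∩ S) + r (A \ S) := by
  have h₁ := hr.submod A S
  have h₂ := hr.submod (A ∪ S) (E \ S)
  have h₃ := hr.submod (A ∩ S) (A \ S)
  rw [show (A ∪ S) ∪ (E \ S) = E by grind, show (A ∪ S) ∩ (E \ S) = A \ S by grind] at h₂
  rw [show (A ∩ S) ∪ (A \ S) = A by grind] at h₃
  omega

theorem charPoly_mul_charPoly (hr : IsRankFun r) {n : ℕ} {E S : Finset α} (hS : S ⊆ E)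
    (h : r S + r (E \ S) = r E) (hn : r E ≤ n) :
    charPoly r n S * charPoly r n (E \ S) = X ^ n * charPoly r n E := by
  rw [charPoly, charPoly, charPoly, Finset.sum_mul_sum, ← Finset.sum_product', Finset.mul_sum]
  refine Finset.sum_nbij' (fun p => p.1 ∪ p.2) (fun A => (A ∩ S, A \ S)) ?_ ?_ ?_ ?_ ?_
  · simp only [Finset.mem_product, Finset.mem_powerset]
    grind
  · simp only [Finset.mem_product, Finset.mem_powerset]
    grind
  · simp only [Finset.mem_product, Finset.mem_powerset, Prod.forall, Prod.mk.injEq]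
    grind
  · simp only [Finset.mem_powerset]
    grind
  · simp only [Finset.mem_product, Finset.mem_powerset, Prod.forall]
    rintro A B ⟨hA, hB⟩
    have hAB : A ∪ B ⊆ E := by grind
    have h₁ := hr.eq_add_of_separator hS h hAB
    rw [show (A ∪ B) ∩ S = A by grind, show (A ∪ B) \ S = B by grind] at h₁
    have h₂ := hr.mono hAB
    rw [Finset.card_union_of_disjoint (Finset.disjoint_left.2 (by grind)), pow_add, h₁]
    have key : (X : ℝ[X]) ^ (n - r A) * X ^ (n - r B) = X ^ n * X ^ (n - (r A + r B)) := by
      rw [← pow_add, ← pow_add]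
      congr 1
      omega
    linear_combination ((-1) ^ A.card * (-1) ^ B.card) * key

theorem Irred.subset_or_subset (hr : IsRankFun r) {E S C : Finset α} (hS : S ⊆ E)
    (h : r S + r (E \ S) = r E) (hC : C ⊆ E) (hi : Irred r C) : C ⊆ S ∨ C ⊆ E \ S := by
  have h₁ := hr.eq_add_of_separator hS h hC
  rcases hi (C ∩ S) Finset.inter_subset_left (by rw [Finset.sdiff_inter_self_left, h₁]) with h' | h'
  · exact Or.inr (Finset.subset_sdiff.2 ⟨hC, Finset.disjoint_iff_inter_eq_empty.2 h'⟩)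
  · exact Or.inl (Finset.inter_eq_left.1 h')

theorem components_eq_union (hr : IsRankFun r) {E S : Finset α} (hS : S ⊆ E)
    (h : r S + r (E \ S) = r E) : components r E = components r S ∪ components r (E \ S) := by
  ext C
  rw [Set.mem_union, mem_components, mem_components, mem_components]
  constructor
  · intro hC
    exact (hC.prop.2.2.subset_or_subset hr hS h hC.prop.1).imp
      (fun h' => ⟨⟨h', hC.prop.2⟩, fun D hD hCD => hC.2 ⟨hD.1.trans hS, hD.2⟩ hCD⟩)
      (fun h' => ⟨⟨h', hC.prop.2⟩,
        fun D hD hCD => hC.2 ⟨hD.1.trans Finset.sdiff_subset, hD.2⟩ hCD⟩)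
  · rintro (hC | hC)
    · refine ⟨⟨hC.prop.1.trans hS, hC.prop.2⟩, fun D hD hCD => hC.2 ⟨?_, hD.2⟩ hCD⟩
      obtain ⟨x, hx⟩ := hC.prop.2.1
      exact (hD.2.2.subset_or_subset hr hS h hD.1).resolve_right fun h' =>
        (Finset.mem_sdiff.1 (h' (hCD hx))).2 (hC.prop.1 hx)
    · refine ⟨⟨hC.prop.1.trans Finset.sdiff_subset, hC.prop.2⟩,
        fun D hD hCD => hC.2 ⟨?_, hD.2⟩ hCD⟩
      obtain ⟨x, hx⟩ := hC.prop.2.1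
      exact (hD.2.2.subset_or_subset hr hS h hD.1).resolve_left fun h' =>
        (Finset.mem_sdiff.1 (hC.prop.1 hx)).2 (h' (hCD hx))

theorem finite_components (r : Finset α → ℕ) (E : Finset α) : (components r E).Finite :=
  E.powerset.finite_toSet.subset fun _ hC =>
    Finset.mem_coe.2 (Finset.mem_powerset.2 (mem_components.1 hC).prop.1)

theorem disjoint_components (r : Finset α → ℕ) {S T : Finset α} (h : Disjoint S T) :
    Disjoint (components r S) (components r T) := by
  refine Set.disjoint_left.2 fun C hS hT => ?_
  rw [mem_components] at hS hT
  obtain ⟨x, hx⟩ := hS.prop.2.1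
  exact Finset.disjoint_left.1 h (hS.prop.1 hx) (hT.prop.1 hx)

theorem Irred.components_eq {E : Finset α} (hE : Irred r E) (hne : E.Nonempty) :
    components r E = {E} := by
  ext C
  rw [mem_components, Set.mem_singleton_iff]
  refine ⟨fun hC => (hC.eq_of_le ⟨subset_rfl, hne, hE⟩ hC.prop.1), ?_⟩
  rintro rfl
  exact ⟨⟨subset_rfl, hne, hE⟩, fun D hD _ => hD.1⟩

theorem Irred.rootMultiplicity_charPoly (hr : IsRankFun r) {n : ℕ} {E : Finset α}
    (hE : Irred r E) (hne : E.Nonempty) (h₀ : r E ≠ 0) (hn : r E ≤ n) :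
    (charPoly r n E).rootMultiplicity 1 = 1 := by
  have hsum : ∑ A ∈ E.powerset, (-1 : ℝ) ^ A.card = 0 := by
    exact_mod_cast Finset.sum_powerset_neg_one_pow_card_of_nonempty hne
  have hroot : (charPoly r n E).IsRoot 1 := by
    simpa [charPoly, IsRoot, eval_finsetSum] using hsum
  have hder : ¬ (derivative (charPoly r n E)).IsRoot 1 := by
    have : eval 1 (derivative (charPoly r n E)) = -(alternatingSum r E : ℝ) := by
      have hterm : ∀ A ∈ E.powerset,
          eval 1 (derivative ((-1) ^ A.card * X ^ (n - r A) : ℝ[X])) =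
            (-1) ^ A.card * n - (-1) ^ A.card * (r A : ℝ) := by
        intro A hA
        have hd : derivative ((-1 : ℝ[X]) ^ A.card) = 0 := by
          rw [show (-1 : ℝ[X]) ^ A.card = C ((-1) ^ A.card) by simp, derivative_C]
        rw [derivative_mul, hd]
        simp [derivative_X_pow, Nat.cast_sub ((hr.mono (Finset.mem_powerset.1 hA)).trans hn), mul_sub]
      rw [charPoly, derivative_sum, eval_finsetSum, Finset.sum_congr rfl hterm,
        Finset.sum_sub_distrib, ← Finset.sum_mul, hsum, alternatingSum]
      push_cast
      ring
    rw [IsRoot, this, neg_eq_zero, Int.cast_eq_zero]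
    intro h
    have := hE.beta_pos hr h₀
    simp [h] at this
  have hpoly : charPoly r n E ≠ 0 := by
    rintro h
    simp [h] at hder
  have h₁ := (rootMultiplicity_pos hpoly).2 hroot
  have h₂ := mt (one_lt_rootMultiplicity_iff_isRoot hpoly).1 fun h => hder h.2
  omega

theorem rootMultiplicity_charPoly (hr : IsRankFun r) {n : ℕ} (E : Finset α)
    (hloop : ∀ e ∈ E, r {e} ≠ 0) (hn : r E ≤ n) :
    charPoly r n E ≠ 0 ∧ (charPoly r n E).rootMultiplicity 1 = (components r E).ncard := by
  have hX : ((X : ℝ[X]) ^ n).rootMultiplicity 1 = 0 := rootMultiplicity_eq_zero (by simp)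
  induction E using Finset.strongInduction with
  | H E ih =>
    obtain rfl | hne := E.eq_empty_or_nonempty
    · have : components r ∅ = ∅ := Set.eq_empty_of_forall_notMem fun C hC =>
        (mem_components.1 hC).prop.2.1.ne_empty
          (Finset.subset_empty.1 (mem_components.1 hC).prop.1)
      simp [charPoly, hr.empty, hX, this]
    by_cases hE : Irred r E
    · have h₀ : r E ≠ 0 := by
        obtain ⟨e, he⟩ := hne
        have h₁ := hr.mono (Finset.singleton_subset_iff.2 he)
        have h₂ := hloop e he
        omega
      have h₁ := hE.rootMultiplicity_charPoly hr hne h₀ hn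
      refine ⟨?_, by rw [h₁, hE.components_eq hne, Set.ncard_singleton]⟩
      intro h
      simp [h] at h₁
    · simp only [Irred, not_forall, not_or] at hE
      obtain ⟨S, hS, h, hS₀, hS₁⟩ := hE
      have h₁ := ih S (hS.ssubset_of_ne hS₁) (fun e he => hloop e (hS he))
        ((hr.mono hS).trans hn)
      have h₂ := ih (E \ S)
        (Finset.sdiff_ssubset hS (Finset.nonempty_iff_ne_empty.2 hS₀))
        (fun e he => hloop e (Finset.sdiff_subset he)) ((hr.mono Finset.sdiff_subset).trans hn)
      have hmul := hr.charPoly_mul_charPoly hS h hn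
      have hprod := mul_ne_zero h₁.1 h₂.1
      refine ⟨right_ne_zero_of_mul (hmul ▸ hprod), ?_⟩
      have h₃ := rootMultiplicity_mul (x := 1) hprod
      rw [hmul, rootMultiplicity_mul (hmul ▸ hprod), hX, zero_add, h₁.2, h₂.2] at h₃
      rw [h₃, hr.components_eq_union hS h, Set.ncard_union_eq
        (disjoint_components r Finset.disjoint_sdiff) (finite_components r _)
        (finite_components r _)]

end IsRankFun

namespace Multigraph

/-- The real functions on the vertices that are constant along every edge of `A`. -/
def constOn (G : Multigraph) (A : Finset G.E) : Submodule ℝ (G.V → ℝ) where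
  carrier := {f | ∀ e ∈ A, f (G.src e) = f (G.tgt e)}
  add_mem' hf hg e he := by simp [hf e he, hg e he]
  zero_mem' _ _ := rfl
  smul_mem' c f hf e he := by simp [hf e he]

theorem mem_constOn {G : Multigraph} {A : Finset G.E} {f : G.V → ℝ} :
    f ∈ G.constOn A ↔ ∀ e ∈ A, f (G.src e) = f (G.tgt e) :=
  Iff.rfl

/-- Functions constant along the edges of `A` are the functions on the set of components. -/
noncomputable def constEquiv (G : Multigraph) (A : Finset G.E) (β : Type*) :
    {f : G.V → β // ∀ e ∈ A, f (G.src e) = f (G.tgt e)} ≃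
      (Quotient (Relation.EqvGen.setoid (fun x y => ∃ e ∈ A, G.src e = x ∧ G.tgt e = y)) → β) :=
  (Equiv.subtypeEquivRight fun f => by
    constructor
    · intro h
      refine Setoid.eqvGen_le ?_
      rintro x y ⟨e, he, rfl, rfl⟩
      exact h e he
    · intro h e he
      exact h (Relation.EqvGen.rel _ _ ⟨e, he, rfl, rfl⟩)).trans (Setoid.liftEquiv _)

theorem card_const (G : Multigraph) (A : Finset G.E) (β : Type*) [Finite β] :
    Nat.card {f : G.V → β // ∀ e ∈ A, f (G.src e) = f (G.tgt e)} =
      Nat.card β ^ G.numComponentsOn A := by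
  rw [Nat.card_congr (G.constEquiv A β), Nat.card_fun, numComponentsOn]

theorem finrank_constOn (G : Multigraph) (A : Finset G.E) :
    Module.finrank ℝ (G.constOn A) = G.numComponentsOn A := by
  let s := Relation.EqvGen.setoid (fun x y => ∃ e ∈ A, G.src e = x ∧ G.tgt e = y)
  have φ : G.constOn A ≃ₗ[ℝ] (Quotient s → ℝ) :=
    { G.constEquiv A ℝ with
      map_add' f g := by
        ext q
        induction q using Quotient.inductionOn
        rfl
      map_smul' c f := by
        ext q
        induction q using Quotient.inductionOn
        rfl }
  have := Fintype.ofFinite (Quotient s)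
  rw [φ.finrank_eq, Module.finrank_fintype_fun_eq_card, numComponentsOn, Nat.card_eq_fintype_card]

theorem constOn_union (G : Multigraph) (A B : Finset G.E) :
    G.constOn (A ∪ B) = G.constOn A ⊓ G.constOn B := by
  ext f
  simp only [Submodule.mem_inf, mem_constOn, Finset.mem_union, or_imp, forall_and]

theorem constOn_anti (G : Multigraph) {A B : Finset G.E} (h : A ⊆ B) :
    G.constOn B ≤ G.constOn A :=
  fun _ hf e he => hf e (h he)

theorem finrank_constOn_empty (G : Multigraph) :
    Module.finrank ℝ (G.constOn ∅) = Fintype.card G.V := by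
  have : G.constOn ∅ = ⊤ := by
    ext f
    simp [mem_constOn]
  rw [this, finrank_top, Module.finrank_fintype_fun_eq_card]

theorem finrank_constOn_le (G : Multigraph) (A : Finset G.E) :
    Module.finrank ℝ (G.constOn A) ≤ Fintype.card G.V :=
  (Submodule.finrank_le _).trans_eq (Module.finrank_fintype_fun_eq_card ℝ)

/-- The rank function of the cycle matroid of `G`. -/
noncomputable def rank (G : Multigraph) (A : Finset G.E) : ℕ :=
  Fintype.card G.V - G.numComponentsOn A

theorem rank_add_finrank (G : Multigraph) (A : Finset G.E) :
    G.rank A + Module.finrank ℝ (G.constOn A) = Fintype.card G.V := by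
  rw [rank, ← finrank_constOn]
  exact Nat.sub_add_cancel (G.finrank_constOn_le A)

theorem finrank_constOn_singleton (G : Multigraph) (e : G.E) :
    Fintype.card G.V ≤ Module.finrank ℝ (G.constOn {e}) + 1 := by
  let φ : (G.V → ℝ) →ₗ[ℝ] ℝ :=
    LinearMap.proj (R := ℝ) (φ := fun _ => ℝ) (G.src e) - LinearMap.proj (G.tgt e)
  have hφ : G.constOn {e} = LinearMap.ker φ := by
    ext f
    simp [mem_constOn, φ, sub_eq_zero]
  have h₁ := φ.finrank_range_add_finrank_ker
  have h₂ := Submodule.finrank_le (LinearMap.range φ)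
  rw [Module.finrank_self] at h₂
  rw [Module.finrank_fintype_fun_eq_card] at h₁
  rw [hφ]
  omega

theorem isRankFun_rank (G : Multigraph) : IsRankFun G.rank where
  empty := by
    have := G.rank_add_finrank ∅
    rw [finrank_constOn_empty] at this
    omega
  mono {A B} h := by
    have h₁ := G.rank_add_finrank A
    have h₂ := G.rank_add_finrank B
    have h₃ := Submodule.finrank_mono (G.constOn_anti h)
    omega
  insert_le e A := by
    have h₁ := G.rank_add_finrank A
    have h₂ := G.rank_add_finrank (insert e A)
    have h₃ := Submodule.finrank_sup_add_finrank_inf_eq (G.constOn A) (G.constOn {e})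
    have h₄ := G.finrank_constOn_singleton e
    have h₅ := Submodule.finrank_le (G.constOn A ⊔ G.constOn {e})
    rw [Module.finrank_fintype_fun_eq_card] at h₅
    rw [← constOn_union, Finset.union_singleton] at h₃
    omega
  submod A B := by
    have h₁ := G.rank_add_finrank A
    have h₂ := G.rank_add_finrank B
    have h₃ := G.rank_add_finrank (A ∪ B)
    have h₄ := G.rank_add_finrank (A ∩ B)
    have h₅ := Submodule.finrank_sup_add_finrank_inf_eq (G.constOn A) (G.constOn B)
    have h₆ := Submodule.finrank_mono (sup_le (G.constOn_anti (Finset.inter_subset_left (s₂ := B)))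
      (G.constOn_anti (Finset.inter_subset_right (s₁ := A))))
    rw [← constOn_union] at h₅
    omega

theorem rank_add_rank_eq_iff (G : Multigraph) (A B : Finset G.E) :
    G.rank A + G.rank B = G.rank (A ∪ B) ↔ G.constOn A ⊔ G.constOn B = ⊤ := by
  have h₁ := G.rank_add_finrank A
  have h₂ := G.rank_add_finrank B
  have h₃ := G.rank_add_finrank (A ∪ B)
  have h₅ := Submodule.finrank_sup_add_finrank_inf_eq (G.constOn A) (G.constOn B)
  rw [← constOn_union] at h₅
  constructor
  · intro h
    refine Submodule.eq_top_of_finrank_eq ?_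
    rw [Module.finrank_fintype_fun_eq_card]
    omega
  · intro h
    rw [h, finrank_top, Module.finrank_fintype_fun_eq_card] at h₅
    omega

theorem Loopless.rank_singleton_ne_zero {G : Multigraph} (hG : G.Loopless) (e : G.E) :
    G.rank {e} ≠ 0 := by
  intro h
  have h₁ := G.rank_add_finrank {e}
  have h₂ : G.constOn {e} = ⊤ := by
    refine Submodule.eq_top_of_finrank_eq ?_
    rw [Module.finrank_fintype_fun_eq_card]
    omega
  have h₃ : Pi.single (G.src e) (1 : ℝ) ∈ G.constOn {e} := h₂ ▸ Submodule.mem_top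
  have h₄ := mem_constOn.1 h₃ e (Finset.mem_singleton_self e)
  rw [Pi.single_eq_same, Pi.single_eq_of_ne (hG e).symm] at h₄
  exact one_ne_zero h₄

theorem properColorings_eq_sum (G : Multigraph) (t : ℕ) :
    (G.properColorings t : ℝ) =
      ∑ A ∈ Finset.univ.powerset, (-1) ^ A.card * (t : ℝ) ^ G.numComponentsOn A := by
  classical
  have hmono : ∀ (A : Finset G.E) (f : G.V → Fin t),
      ∏ e ∈ A, -(if f (G.src e) = f (G.tgt e) then (1 : ℝ) else 0) =
        (-1) ^ A.card * if ∀ e ∈ A, f (G.src e) = f (G.tgt e) then 1 else 0 := by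
    intro A f
    rw [Finset.prod_neg, Finset.prod_ite_zero]
    simp
  have hcol : ∀ f : G.V → Fin t,
      (if ∀ e, f (G.src e) ≠ f (G.tgt e) then (1 : ℝ) else 0) =
        ∏ e, (1 + -(if f (G.src e) = f (G.tgt e) then (1 : ℝ) else 0)) := by
    intro f
    have : ∀ e, (1 + -(if f (G.src e) = f (G.tgt e) then (1 : ℝ) else 0)) =
        if f (G.src e) ≠ f (G.tgt e) then 1 else 0 := by
      intro e
      split_ifs <;> simp_all
    simp only [this, Finset.prod_ite_zero, Finset.prod_const_one, Finset.mem_univ, true_imp_iff]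
  calc (G.properColorings t : ℝ)
      = ∑ f : G.V → Fin t, if ∀ e, f (G.src e) ≠ f (G.tgt e) then (1 : ℝ) else 0 := by
        rw [properColorings, Nat.card_eq_fintype_card, Fintype.card_subtype, Finset.sum_boole]
    _ = ∑ f : G.V → Fin t, ∑ A ∈ Finset.univ.powerset,
          (-1) ^ A.card * if ∀ e ∈ A, f (G.src e) = f (G.tgt e) then (1 : ℝ) else 0 := by
        simp only [hcol, Finset.prod_one_add, hmono]
    _ = _ := by
        rw [Finset.sum_comm]
        refine Finset.sum_congr rfl fun A _ => ?_
        rw [← Finset.mul_sum, Finset.sum_boole, ← Fintype.card_subtype, ← Nat.card_eq_fintype_card,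
          card_const, Nat.card_eq_fintype_card, Fintype.card_fin, Nat.cast_pow]

theorem IsChromaticPoly.eq_charPoly {G : Multigraph} {P : ℝ[X]} (hP : G.IsChromaticPoly P) :
    P = IsRankFun.charPoly G.rank (Fintype.card G.V) Finset.univ := by
  refine eq_of_infinite_eval_eq _ _ (Set.Infinite.mono ?_
    ((Set.Ioi_infinite 0).image Nat.cast_injective.injOn))
  rintro _ ⟨t, ht, rfl⟩
  rw [Set.mem_ofPred_eq, hP t ht, properColorings_eq_sum, IsRankFun.charPoly, eval_finsetSum]
  refine Finset.sum_congr rfl fun A _ => ?_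
  have h₁ := G.rank_add_finrank A
  rw [finrank_constOn] at h₁
  rw [show Fintype.card G.V - G.rank A = G.numComponentsOn A by omega]
  simp

end Multigraph

namespace Multigraph

variable {G : Multigraph}

open IsRankFun

/-- The edge `e` is incident to the vertex `v`. -/
def Incident (G : Multigraph) (e : G.E) (v : G.V) : Prop := G.src e = v ∨ G.tgt e = v

/-- The subgraph formed by a set of edges and their endpoints. -/
def edgeSubgr (G : Multigraph) (S : Finset G.E) : Subgr G where
  verts := {v | ∃ e ∈ S, G.Incident e v}
  edges := S
  src_mem e he := ⟨e, he, Or.inl rfl⟩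
  tgt_mem e he := ⟨e, he, Or.inr rfl⟩

theorem Subgr.ext_of_eq {H K : Subgr G} (hv : H.verts = K.verts) (he : H.edges = K.edges) :
    H = K := by
  cases H
  cases K
  congr

theorem Subgr.ReachIn.eq_of_const {H : Subgr G} {a b : G.V} (h : H.ReachIn a b) {β : Sort*}
    {f : G.V → β} (hf : ∀ e ∈ H.edges, f (G.src e) = f (G.tgt e)) : f a = f b := by
  induction h with
  | rel x y hxy =>
    obtain ⟨e, he, rfl, rfl⟩ := hxy
    exact hf e he
  | refl => rfl
  | symm _ _ _ ih => exact ih.symm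
  | trans _ _ _ _ _ ih₁ ih₂ => exact ih₁.trans ih₂

theorem Subgr.reachIn_edge {H : Subgr G} {e : G.E} (he : e ∈ H.edges) :
    H.ReachIn (G.src e) (G.tgt e) :=
  Relation.EqvGen.rel _ _ ⟨e, he, rfl, rfl⟩

/-- If all edges of `S` leaving `U` end in a single vertex `v`, then `S` splits into the edges
meeting `U` and the remaining ones. -/
theorem irred_cut {S : Finset G.E} (hS : Irred G.rank S) {U : Set G.V} {v : G.V}
    (hsrc : ∀ e ∈ S, G.src e ∈ U → G.tgt e = v ∨ G.tgt e ∈ U)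
    (htgt : ∀ e ∈ S, G.tgt e ∈ U → G.src e = v ∨ G.src e ∈ U)
    (h₁ : ∃ e ∈ S, G.src e ∈ U ∨ G.tgt e ∈ U) :
    ∀ e ∈ S, G.src e ∈ U ∨ G.tgt e ∈ U := by
  classical
  have hsep := hS (S.filter fun e => G.src e ∈ U ∨ G.tgt e ∈ U) (Finset.filter_subset _ _) ?_
  · obtain ⟨e, he, heU⟩ := h₁
    rcases hsep with h | h
    · exact absurd (h ▸ Finset.mem_filter.2 ⟨he, heU⟩) (Finset.notMem_empty e)
    · intro e he
      rw [← h] at he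
      exact (Finset.mem_filter.1 he).2
  · have key := G.rank_add_rank_eq_iff (S.filter fun e => G.src e ∈ U ∨ G.tgt e ∈ U)
      (S \ S.filter fun e => G.src e ∈ U ∨ G.tgt e ∈ U)
    rw [Finset.union_sdiff_of_subset (Finset.filter_subset _ _)] at key
    refine key.2 (eq_top_iff.2 fun f _ => Submodule.mem_sup.2
      ⟨fun x => if x ∈ U then f v else f x, fun e he => ?_,
        fun x => if x ∈ U then f x - f v else 0, fun e he => ?_, ?_⟩)
    · obtain ⟨he, h⟩ := Finset.mem_filter.1 he
      have hs := hsrc e he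
      have ht := htgt e he
      dsimp only
      split_ifs with h₃ h₄ h₄
      · rfl
      · rw [(hs h₃).resolve_right h₄]
      · rw [(ht h₄).resolve_right h₃]
      · exact absurd h (not_or.2 ⟨h₃, h₄⟩)
    · simp only [Finset.mem_sdiff, Finset.mem_filter, not_and, not_or] at he
      have h := he.2 he.1
      simp [h.1, h.2]
    · ext x
      by_cases hx : x ∈ U <;> simp [hx]

theorem nonseparable_edgeSubgr {S : Finset G.E} (hS : Irred G.rank S) (hne : S.Nonempty) :
    (G.edgeSubgr S).Nonseparable := by
  obtain ⟨e₀, he₀⟩ := hne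
  refine ⟨⟨⟨G.src e₀, e₀, he₀, Or.inl rfl⟩, ?_⟩, fun v _ => ?_⟩
  · rintro a ⟨e₁, he₁, h₁⟩ b ⟨e₂, he₂, h₂⟩
    by_contra hab
    have hstep : ∀ e ∈ S, (G.edgeSubgr S).ReachIn a (G.src e) ↔
        (G.edgeSubgr S).ReachIn a (G.tgt e) := fun e he =>
      ⟨fun h => h.trans _ _ _ (Subgr.reachIn_edge he),
        fun h => h.trans _ _ _ (Subgr.reachIn_edge he).symm⟩
    have hcut := irred_cut hS (U := {x | (G.edgeSubgr S).ReachIn a x}) (v := b)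
      (fun e he h => Or.inr ((hstep e he).1 h)) (fun e he h => Or.inr ((hstep e he).2 h))
      ⟨e₁, he₁, by
        rcases h₁ with rfl | rfl
        exacts [Or.inl (Relation.EqvGen.refl _), Or.inr (Relation.EqvGen.refl _)]⟩ e₂ he₂
    have hboth := hstep e₂ he₂
    simp only [Set.mem_ofPred_eq] at hcut
    rcases h₂ with rfl | rfl <;> tauto
  · rw [or_iff_not_imp_left, ← Ne, ← Set.nonempty_iff_ne_empty]
    refine fun hv => ⟨hv, ?_⟩
    rintro a ⟨⟨e₁, he₁, h₁⟩, hav⟩ b ⟨⟨e₂, he₂, h₂⟩, hbv⟩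
    rw [Set.mem_singleton_iff] at hav hbv
    set K := (G.edgeSubgr S).deleteVert v
    by_contra hab
    have hstep : ∀ e ∈ S, G.src e ≠ v → G.tgt e ≠ v →
        K.ReachIn (G.src e) (G.tgt e) := fun e he hs ht => Subgr.reachIn_edge ⟨he, hs, ht⟩
    have hcut := irred_cut hS (U := {x | x ≠ v ∧ K.ReachIn a x}) (v := v)
      (fun e he h => or_iff_not_imp_left.2 fun ht =>
        ⟨ht, h.2.trans _ _ _ (hstep e he h.1 ht)⟩)
      (fun e he h => or_iff_not_imp_left.2 fun hs =>
        ⟨hs, h.2.trans _ _ _ (hstep e he hs h.1).symm⟩)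
      ⟨e₁, he₁, by
        rcases h₁ with rfl | rfl
        exacts [Or.inl ⟨hav, Relation.EqvGen.refl _⟩, Or.inr ⟨hav, Relation.EqvGen.refl _⟩]⟩ e₂ he₂
    have hboth := hstep e₂ he₂
    rcases h₂ with rfl | rfl <;> rcases hcut with h | h
    · exact hab h.2
    · exact hab (h.2.trans _ _ _ (hboth hbv h.1).symm)
    · exact hab (h.2.trans _ _ _ (hboth h.1 hbv))
    · exact hab h.2

theorem Loopless.exists_other_end (hG : G.Loopless) {H : Subgr G} {e : G.E} (he : e ∈ H.edges)
    {v : G.V} (hv : G.Incident e v) :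
    ∃ x ∈ H.verts, x ≠ v ∧ ∀ f : G.V → ℝ, f (G.src e) = f (G.tgt e) → f v = f x := by
  rcases hv with rfl | rfl
  · exact ⟨G.tgt e, H.tgt_mem e he, (hG e).symm, fun _ h => h⟩
  · exact ⟨G.src e, H.src_mem e he, hG e, fun _ h => h.symm⟩

theorem Subgr.ConnIn.exists_common_vertex {H : Subgr G} (hH : H.ConnIn) {S T : Finset G.E}
    (hST : ∀ e, e ∈ H.edges ↔ e ∈ S ∨ e ∈ T) (hS : S.Nonempty) (hT : T.Nonempty) :
    ∃ v ∈ H.verts, (∃ e ∈ S, G.Incident e v) ∧ ∃ e ∈ T, G.Incident e v := by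
  by_contra! hcon
  obtain ⟨e₁, he₁⟩ := hS
  obtain ⟨e₂, he₂⟩ := hT
  have h₁ := (hST e₁).2 (Or.inl he₁)
  have h₂ := (hST e₂).2 (Or.inr he₂)
  have hreach := hH.2 _ (H.src_mem e₁ h₁) _ (H.src_mem e₂ h₂)
  have heq := hreach.eq_of_const (f := fun v => ∃ e ∈ S, G.Incident e v) fun e he => by
    rcases (hST e).1 he with h | h
    · exact propext ⟨fun _ => ⟨e, h, Or.inr rfl⟩, fun _ => ⟨e, h, Or.inl rfl⟩⟩
    · exact propext ⟨fun h' => absurd (Or.inl rfl) (hcon _ (H.src_mem e he) h' e h),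
        fun h' => absurd (Or.inr rfl) (hcon _ (H.tgt_mem e he) h' e h)⟩
  exact hcon _ (H.src_mem e₂ h₂) (heq.mp ⟨e₁, he₁, Or.inl rfl⟩) e₂ he₂ (Or.inl rfl)

theorem Subgr.Nonseparable.irred (hG : G.Loopless) {H : Subgr G} (hH : H.Nonseparable)
    {S : Finset G.E} (hS : H.edges = S) : Irred G.rank S := by
  intro S₁ hS₁ hsep
  by_contra! hcon
  have hST : ∀ e, e ∈ H.edges ↔ e ∈ S₁ ∨ e ∈ S \ S₁ := by
    intro e
    rw [hS, Finset.mem_coe]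
    grind
  obtain ⟨v, hv, ⟨e₁, he₁, hv₁⟩, e₂, he₂, hv₂⟩ := hH.1.exists_common_vertex hST hcon.1
    (Finset.sdiff_nonempty.2 fun h => hcon.2 (hS₁.antisymm h))
  obtain ⟨x, hx, hxv, hfx⟩ := hG.exists_other_end ((hST e₁).2 (Or.inl he₁)) hv₁
  obtain ⟨y, hy, hyv, hfy⟩ := hG.exists_other_end ((hST e₂).2 (Or.inr he₂)) hv₂
  have htop := G.rank_add_rank_eq_iff S₁ (S \ S₁)
  rw [Finset.union_sdiff_of_subset hS₁] at htop
  obtain ⟨g, hg, h, hh, hgh⟩ := Submodule.mem_sup.1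
    (htop.1 hsep ▸ Submodule.mem_top : Pi.single v (1 : ℝ) ∈ _)
  have hsum : ∀ z ≠ v, g z + h z = 0 := fun z hz => by
    rw [← Pi.add_apply, hgh, Pi.single_eq_of_ne hz]
  have hsum_v : g v + h v = 1 := by
    rw [← Pi.add_apply, hgh, Pi.single_eq_same]
  have hconn := (hH.2 v hv).resolve_left (Set.nonempty_iff_ne_empty.1 ⟨x, hx, hxv⟩)
  have hgxy := (hconn.2 x ⟨hx, hxv⟩ y ⟨hy, hyv⟩).eq_of_const (f := g) <| by
    rintro e ⟨he, hs, ht⟩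
    rcases (hST e).1 he with h' | h'
    · exact hg e h'
    · linarith [hh e h', hsum _ hs, hsum _ ht]
  linarith [hfx g (hg e₁ he₁), hfy h (hh e₂ he₂), hsum y hyv]

theorem Subgr.ConnIn.eq_edgeSubgr {H : Subgr G} (hH : H.ConnIn) {S : Finset G.E}
    (hS : H.edges = S) (hne : S.Nonempty) : H = G.edgeSubgr S := by
  refine Subgr.ext_of_eq (Set.Subset.antisymm (fun v hv => ?_) ?_) hS
  · obtain ⟨e, he⟩ := hne
    have heH : e ∈ H.edges := by
      rw [hS]
      exact he
    have := (hH.2 _ (H.src_mem e heH) v hv).eq_of_const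
      (f := fun v => ∃ e ∈ S, G.Incident e v) fun e' he' => by
        rw [hS] at he'
        exact propext ⟨fun _ => ⟨e', he', Or.inr rfl⟩, fun _ => ⟨e', he', Or.inl rfl⟩⟩
    exact this.mp ⟨e, he, Or.inl rfl⟩
  · rintro v ⟨e, he, rfl | rfl⟩
    · exact H.src_mem e (hS ▸ he)
    · exact H.tgt_mem e (hS ▸ he)

theorem edgeSubgr_verts_mono {S T : Finset G.E} (h : S ⊆ T) :
    (G.edgeSubgr S).verts ⊆ (G.edgeSubgr T).verts :=
  fun _ ⟨e, he, hv⟩ => ⟨e, h he, hv⟩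

theorem Loopless.isBlock_edgeSubgr (hG : G.Loopless) {S : Finset G.E}
    (hS : S ∈ components G.rank Finset.univ) : (G.edgeSubgr S).IsBlock := by
  rw [mem_components] at hS
  obtain ⟨⟨-, hne, hirr⟩, hmax⟩ := hS
  refine ⟨nonseparable_edgeSubgr hirr hne, fun K hK _ hSK => ?_⟩
  obtain ⟨T, hT⟩ := K.edges.toFinite.exists_finset_coe
  have hST : S ⊆ T := by
    rw [← hT] at hSK
    exact Finset.coe_subset.1 hSK
  have hTS := hmax ⟨Finset.subset_univ T, hne.mono hST, hK.irred hG hT.symm⟩ hST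
  rw [hK.1.eq_edgeSubgr hT.symm (hne.mono hST), hST.antisymm hTS]
  exact ⟨rfl, rfl⟩

theorem Loopless.exists_eq_edgeSubgr (hG : G.Loopless) {H : Subgr G} (hH : H.IsBlock)
    (hne : H.edges.Nonempty) :
    ∃ S ∈ components G.rank Finset.univ, G.edgeSubgr S = H := by
  obtain ⟨S, hS⟩ := H.edges.toFinite.exists_finset_coe
  have hneS : S.Nonempty := by
    rw [← hS] at hne
    exact hne
  obtain rfl := hH.1.1.eq_edgeSubgr hS.symm hneS
  refine ⟨S, mem_components.2 ⟨⟨Finset.subset_univ S, hneS, hH.1.irred hG rfl⟩, ?_⟩, rfl⟩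
  rintro T ⟨-, hneT, hT⟩ hST
  have := (hH.2 _ (nonseparable_edgeSubgr hT hneT) (edgeSubgr_verts_mono hST)
    (Finset.coe_subset.2 hST)).2
  exact Finset.coe_subset.1 this.subset

theorem Loopless.numEdgeBlocks_eq (hG : G.Loopless) :
    G.numEdgeBlocks = (components G.rank Finset.univ).ncard := by
  rw [numEdgeBlocks, ← Nat.card_coe_set_eq]
  symm
  refine Nat.card_eq_of_bijective
    (fun S : components G.rank Finset.univ =>
      (⟨G.edgeSubgr S, hG.isBlock_edgeSubgr S.2, (mem_components.1 S.2).prop.2.1⟩ :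
        {H : Subgr G // H.IsBlock ∧ H.edges.Nonempty})) ⟨?_, ?_⟩
  · intro S T h
    exact Subtype.ext (Finset.coe_injective (congrArg (fun H => H.1.edges) h))
  · rintro ⟨H, hH, hne⟩
    obtain ⟨S, hS, rfl⟩ := hG.exists_eq_edgeSubgr hH hne
    exact ⟨⟨S, hS⟩, rfl⟩

end Multigraph

/-- For a loopless graph, `P(G,t)` has a zero of multiplicity exactly `b` at `t = 1`,
where `b` is the number of blocks of `G` that are not isolated vertices. -/
theorem chromatic_multiplicity_at_one (G : Multigraph) (hG : G.Loopless)
    (P : Polynomial ℝ) (hP : G.IsChromaticPoly P) :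
    P.rootMultiplicity 1 = G.numEdgeBlocks := by
  rw [hP.eq_charPoly, hG.numEdgeBlocks_eq]
  exact (G.isRankFun_rank.rootMultiplicity_charPoly Finset.univ
    (fun e _ => hG.rank_singleton_ne_zero e) (Nat.sub_le _ _)).2
end

section
/- Every loopless simple planar graph G satisfies P(G,t) > 0 for all real t ≥ 5. -/
open Polynomial

/-- `P` is the chromatic polynomial of the simple graph `G`: its value at each
positive integer `t` is the number of proper `t`-colourings of `G`. -/
def SimpleGraph.IsChromaticPoly {V : Type*} (G : SimpleGraph V) (P : Polynomial ℝ) : Prop :=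
  ∀ t : ℕ, 0 < t → P.eval (t : ℝ) = Nat.card (G.Coloring (Fin t))

/-- `G` is planar: it admits an embedding in the plane in which vertices are
distinct points, each edge is a simple continuous arc joining the positions of
its endpoints, the interiors of arcs avoid all vertex points, and the interiors
of arcs of distinct edges are disjoint. -/
def SimpleGraph.IsPlanar {V : Type*} (G : SimpleGraph V) : Prop :=
  ∃ (pos : V → ℝ × ℝ) (arc : ∀ ⦃u v : V⦄, G.Adj u v → unitInterval → ℝ × ℝ),
    Function.Injective pos ∧
    (∀ ⦃u v : V⦄ (h : G.Adj u v), Continuous (arc h)) ∧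
    (∀ ⦃u v : V⦄ (h : G.Adj u v), arc h 0 = pos u ∧ arc h 1 = pos v) ∧
    (∀ ⦃u v : V⦄ (h : G.Adj u v) (s : unitInterval), arc h.symm s = arc h (unitInterval.symm s)) ∧
    (∀ ⦃u v : V⦄ (h : G.Adj u v), Function.Injective (arc h)) ∧
    (∀ ⦃u v : V⦄ (h : G.Adj u v) (s : unitInterval), s ≠ 0 → s ≠ 1 →
      ∀ w : V, arc h s ≠ pos w) ∧
    (∀ ⦃u v u' v' : V⦄ (h : G.Adj u v) (h' : G.Adj u' v'),
      ¬(u = u' ∧ v = v') → ¬(u = v' ∧ v = u') →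
      ∀ s t : unitInterval, s ≠ 0 → s ≠ 1 → t ≠ 0 → t ≠ 1 → arc h s ≠ arc h' t)


section ContinuousArgument

/-- A nonvanishing continuous complex function on a simply connected space has a continuous
argument. -/
theorem exists_continuous_arg {A : Type*} [TopologicalSpace A] [SimplyConnectedSpace A]
    [LocallyPathConnectedSpace A] (f : A → ℂ) (hf : Continuous f) (h0 : ∀ a, f a ≠ 0) :
    ∃ θ : A → ℝ, Continuous θ ∧ ∀ a, f a = ‖f a‖ * (Circle.exp (θ a) : ℂ) := by
  have hn : ∀ a, (‖f a‖ : ℂ) ≠ 0 := fun a => by simpa using h0 a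
  have hmem : ∀ a, f a / ‖f a‖ ∈ Submonoid.unitSphere ℂ := fun a => by
    have : ‖f a‖ ≠ 0 := by simpa using h0 a
    simp [Submonoid.unitSphere, this]
  have hc : Continuous fun a => f a / (‖f a‖ : ℂ) :=
    hf.div (Complex.continuous_ofReal.comp hf.norm) hn
  let g : C(A, Circle) := ⟨fun a => ⟨f a / ‖f a‖, hmem a⟩, hc.subtype_mk _⟩
  obtain ⟨a₀⟩ : Nonempty A := inferInstance
  have he : Circle.exp (Complex.arg (g a₀)) = g a₀ := Circle.exp_arg _
  obtain ⟨F, ⟨-, hF⟩, -⟩ := Circle.isCoveringMap_exp.existsUnique_continuousMap_lifts g a₀ _ he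
  refine ⟨F, F.continuous, fun a => ?_⟩
  have h1 : (Circle.exp (F a) : ℂ) = f a / ‖f a‖ := congrArg Subtype.val (congrFun hF a)
  rw [h1, mul_div_cancel₀ _ (hn a)]

theorem sub_eq_sub_of_circleExp_eq {θ θ' : ℝ → ℝ} (hθ : Continuous θ) (hθ' : Continuous θ')
    (c : Circle) (h : ∀ t, Circle.exp (θ t) = c * Circle.exp (θ' t)) :
    θ 1 - θ 0 = θ' 1 - θ' 0 := by
  have key : θ = fun t => θ' t + (θ 0 - θ' 0) := by
    refine Circle.isCoveringMap_exp.eq_of_comp_eq hθ (by fun_prop) ?_ 0 (by simp)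
    funext t
    simp only [Function.comp_apply, Circle.exp_add, Circle.exp_sub, h]
    simp [mul_comm]
  linarith [congrFun key 1]

theorem circleExp_eq_of_norm_mul_eq {z : ℂ} (hz : z ≠ 0) {a b : Circle}
    (ha : z = ‖z‖ * (a : ℂ)) (hb : z = ‖z‖ * (b : ℂ)) : a = b := by
  have hn : (‖z‖ : ℂ) ≠ 0 := by simpa using hz
  exact Circle.ext (mul_left_cancel₀ hn (ha.symm.trans hb))

/-- Any drawing of `K₅` in the plane has two disjoint edges whose images intersect. -/
theorem exists_crossing_of_complete_five (p : Fin 5 → ℂ) (γ : Fin 5 → Fin 5 → ℝ → ℂ)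
    (hc : ∀ i j, i < j → Continuous (γ i j)) (h0 : ∀ i j, i < j → γ i j 0 = p i)
    (h1 : ∀ i j, i < j → γ i j 1 = p j)
    (hv : ∀ m k l, k < l → m ≠ k → m ≠ l → ∀ t, p m ≠ γ k l t)
    (hd : ∀ i j k l, i < j → k < l → i ≠ k → i ≠ l → j ≠ k → j ≠ l →
      ∀ s t, γ i j s ≠ γ k l t) : False := by
  have hinj : ∀ i j, i ≠ j → p i ≠ p j := by
    intro i j hij
    obtain ⟨k, hk, hk'⟩ : ∃ k : Fin 5, k ≠ i ∧ k ≠ j := by decide +revert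
    rcases lt_or_gt_of_ne hk' with h | h
    · rw [← h1 k j h]; exact hv _ _ _ h hk.symm hij _
    · rw [← h0 j k h]; exact hv _ _ _ h hij hk.symm _
  -- arguments of the directions between the vertices
  obtain ⟨A, hsymm, hA⟩ : ∃ A : Fin 5 → Fin 5 → ℝ, (∀ i j, A i j = A j i) ∧
      ∀ i j, i ≠ j → p i - p j =
        ‖p i - p j‖ * (Circle.exp (A i j + Real.pi * (if i < j then 0 else 1 : ℤ)) : ℂ) := by
    refine ⟨fun i j => if i < j then (p i - p j).arg else (p j - p i).arg, ?_, ?_⟩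
    · intro i j
      rcases lt_trichotomy i j with h | h | h
      · simp [h, h.not_gt]
      · simp [h]
      · simp [h, h.not_gt]
    · intro i j hij
      rcases lt_or_gt_of_ne hij with h | h
      · simp [h, Complex.norm_mul_exp_arg_mul_I]
      · have := Complex.norm_mul_exp_arg_mul_I (p j - p i)
        simp only [h.not_gt, if_false, Circle.coe_exp, Int.cast_one, mul_one]
        push_cast
        rw [add_mul, Complex.exp_add, Complex.exp_pi_mul_I, norm_sub_rev]
        linear_combination this
  have hlift : ∀ m k l, ∃ q : ℝ → ℝ, k < l → m ≠ k → m ≠ l →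
      Continuous q ∧ ∀ t, p m - γ k l t = ‖p m - γ k l t‖ * (Circle.exp (q t) : ℂ) := by
    intro m k l
    by_cases h : k < l ∧ m ≠ k ∧ m ≠ l
    · obtain ⟨q, hq⟩ := exists_continuous_arg (fun t => p m - γ k l t)
        (continuous_const.sub (hc k l h.1))
        (fun t => sub_ne_zero.2 (hv m k l h.1 h.2.1 h.2.2 t))
      exact ⟨q, fun _ _ _ => hq⟩
    · exact ⟨0, fun a b c => absurd ⟨a, b, c⟩ h⟩
  choose θ hθ using hlift
  let e : Fin 5 → Fin 5 → ℤ := fun i j => if i < j then 0 else 1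
  have hint : ∀ m k l, ∃ n : ℤ, k < l → m ≠ k → m ≠ l →
      θ m k l 1 - θ m k l 0 =
        (A m l + Real.pi * e m l) - (A m k + Real.pi * e m k) + 2 * Real.pi * n := by
    intro m k l
    by_cases h : k < l ∧ m ≠ k ∧ m ≠ l
    · obtain ⟨h, h', h''⟩ := h
      have e1 := (hθ m k l h h' h'').2 1
      have e0 := (hθ m k l h h' h'').2 0
      rw [h1 k l h] at e1
      rw [h0 k l h] at e0
      have f1 := circleExp_eq_of_norm_mul_eq (sub_ne_zero.2 (hinj m l h'')) e1 (hA m l h'')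
      have f0 := circleExp_eq_of_norm_mul_eq (sub_ne_zero.2 (hinj m k h')) e0 (hA m k h')
      obtain ⟨n1, hn1⟩ := Circle.exp_eq_exp.1 f1
      obtain ⟨n0, hn0⟩ := Circle.exp_eq_exp.1 f0
      refine ⟨n1 - n0, fun _ _ _ => ?_⟩
      rw [hn1, hn0]
      simp only [e]
      push_cast
      ring
    · exact ⟨0, fun a b c => absurd ⟨a, b, c⟩ h⟩
  choose n hn using hint
  have hsq : ∀ i j k l, i < j → k < l → i ≠ k → i ≠ l → j ≠ k → j ≠ l →
      (θ i k l 1 - θ i k l 0) + (θ l i j 1 - θ l i j 0) =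
        (θ k i j 1 - θ k i j 0) + (θ j k l 1 - θ j k l 0) := by
    intro i j k l hij hkl hik hil hjk hjl
    have cij := hc i j hij
    have ckl := hc k l hkl
    obtain ⟨Θ, hΘc, hΘ⟩ := exists_continuous_arg (A := ℝ × ℝ) (fun x => γ i j x.1 - γ k l x.2)
      (by fun_prop) (fun x => sub_ne_zero.2 (hd i j k l hij hkl hik hil hjk hjl _ _))
    have ne : ∀ m k l, k < l → m ≠ k → m ≠ l → ∀ t, p m - γ k l t ≠ 0 :=
      fun m k l a b c t => sub_ne_zero.2 (hv m k l a b c t)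
    have v1 : ∀ m k l, k < l → m ≠ k → m ≠ l → ∀ q : ℝ → ℝ, Continuous q →
        (∀ t, p m - γ k l t = ‖p m - γ k l t‖ * (Circle.exp (q t) : ℂ)) →
        q 1 - q 0 = θ m k l 1 - θ m k l 0 := by
      intro m k l h h' h'' q hq hq'
      refine sub_eq_sub_of_circleExp_eq hq (hθ m k l h h' h'').1 1 fun t => ?_
      rw [one_mul]
      exact circleExp_eq_of_norm_mul_eq (ne m k l h h' h'' t) (hq' t) ((hθ m k l h h' h'').2 t)
    have v2 : ∀ m k l, k < l → m ≠ k → m ≠ l → ∀ q : ℝ → ℝ, Continuous q →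
        (∀ t, γ k l t - p m = ‖γ k l t - p m‖ * (Circle.exp (q t) : ℂ)) →
        q 1 - q 0 = θ m k l 1 - θ m k l 0 := by
      intro m k l h h' h'' q hq hq'
      have := v1 m k l h h' h'' (fun t => q t + Real.pi) (by fun_prop) (fun t => by
        have e := hq' t
        rw [Circle.exp_add, norm_sub_rev]
        simp only [Circle.coe_mul, Circle.coe_exp, Complex.exp_pi_mul_I] at e ⊢
        linear_combination -e)
      linarith
    have a1 := v1 i k l hkl hik hil (fun t => Θ (0, t)) (by fun_prop)
      (fun t => by simpa [h0 i j hij] using hΘ (0, t))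
    have a2 := v1 j k l hkl hjk hjl (fun t => Θ (1, t)) (by fun_prop)
      (fun t => by simpa [h1 i j hij] using hΘ (1, t))
    have a3 := v2 k i j hij hik.symm hjk.symm (fun t => Θ (t, 0)) (by fun_prop)
      (fun t => by simpa [h0 k l hkl] using hΘ (t, 0))
    have a4 := v2 l i j hij hil.symm hjl.symm (fun t => Θ (t, 1)) (by fun_prop)
      (fun t => by simpa [h1 k l hkl] using hΘ (t, 1))
    linarith
  have hfin : ∀ i j k l, i < j → k < l → i ≠ k → i ≠ l → j ≠ k → j ≠ l →
      2 * (n i k l + n l i j - n k i j - n j k l) +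
        (e i l - e i k + e l j - e l i - e k j + e k i - e j l + e j k) = 0 := by
    intro i j k l hij hkl hik hil hjk hjl
    have hs := hsq i j k l hij hkl hik hil hjk hjl
    rw [hn i k l hkl hik hil, hn l i j hij hil.symm hjl.symm, hn k i j hij hik.symm hjk.symm,
      hn j k l hkl hjk hjl] at hs
    have hr : Real.pi * ((2 * (n i k l + n l i j - n k i j - n j k l) +
        (e i l - e i k + e l j - e l i - e k j + e k i - e j l + e j k) : ℤ) : ℝ) = 0 := by
      push_cast
      linear_combination hs + hsymm i k - hsymm i l - hsymm l j + hsymm k j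
    exact_mod_cast (mul_eq_zero.1 hr).resolve_left Real.pi_ne_zero
  have h4 : ∀ a b c d : Fin 5, a < b → b < c → c < d →
      (n a c d + n d a b - n c a b - n b c d = 0) ∧ (n a b d + n d a c - n b a c - n c b d = -1) ∧
      (n a b c + n c a d - n b a d - n d b c = 0) := by
    intro a b c d hab hbc hcd
    have hac := hab.trans hbc
    have hbd := hbc.trans hcd
    have had := hab.trans hbd
    have q1 := hfin a b c d hab hcd hac.ne had.ne hbc.ne hbd.ne
    have q2 := hfin a c b d hac hbd hab.ne had.ne hbc.ne' hcd.ne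
    have q3 := hfin a d b c had hbc hab.ne hac.ne hbd.ne' hcd.ne'
    simp only [e, hab, hbc, hcd, hac, hbd, had, hab.not_gt, hbc.not_gt, hcd.not_gt, hac.not_gt,
      hbd.not_gt, had.not_gt, if_true, if_false] at q1 q2 q3
    omega
  have t1 := h4 0 1 2 3 (by decide) (by decide) (by decide)
  have t2 := h4 0 1 2 4 (by decide) (by decide) (by decide)
  have t3 := h4 0 1 3 4 (by decide) (by decide) (by decide)
  have t4 := h4 0 2 3 4 (by decide) (by decide) (by decide)
  have t5 := h4 1 2 3 4 (by decide) (by decide) (by decide)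
  clear h4 hfin hn hsq
  omega

end ContinuousArgument

namespace SimpleGraph

section Almost

variable {V W : Type*}

/-- `x` and `y` are joined by a walk of `G` with all its vertices in `A`. -/
def JoinedWithin (G : SimpleGraph V) (A : Set V) (x y : V) : Prop :=
  x ∈ A ∧ Relation.ReflTransGen (fun a b => G.Adj a b ∧ b ∈ A) x y

theorem JoinedWithin.mem_right {G : SimpleGraph V} {A : Set V} {x y : V}
    (h : G.JoinedWithin A x y) : y ∈ A := by
  rcases Relation.ReflTransGen.cases_tail h.2 with h' | ⟨_, _, h'⟩
  · exact h' ▸ h.1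
  · exact h'.2

theorem JoinedWithin.refl {G : SimpleGraph V} {A : Set V} {x : V} (hx : x ∈ A) :
    G.JoinedWithin A x x := ⟨hx, .refl⟩

theorem JoinedWithin.trans {G : SimpleGraph V} {A : Set V} {x y z : V}
    (h : G.JoinedWithin A x y) (h' : G.JoinedWithin A y z) : G.JoinedWithin A x z :=
  ⟨h.1, h.2.trans h'.2⟩

theorem JoinedWithin.of_adj {G : SimpleGraph V} {A : Set V} {x y : V} (hx : x ∈ A) (hy : y ∈ A)
    (h : G.Adj x y) : G.JoinedWithin A x y := ⟨hx, .single ⟨h, hy⟩⟩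

theorem JoinedWithin.mono {G : SimpleGraph V} {A B : Set V} {x y : V} (hAB : A ⊆ B)
    (h : G.JoinedWithin A x y) : G.JoinedWithin B x y :=
  ⟨hAB h.1, Relation.ReflTransGen.mono (fun _ _ h' => ⟨h'.1, hAB h'.2⟩) _ _ h.2⟩

theorem joinedWithin_of_hub {G : SimpleGraph V} {A : Set V} {v : V} (hv : v ∈ A)
    (h : ∀ x ∈ A, x = v ∨ G.Adj v x) : ∀ x ∈ A, ∀ y ∈ A, G.JoinedWithin A x y := by
  intro x hx y hy
  refine JoinedWithin.trans (y := v) ?_ ?_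
  · rcases h x hx with rfl | h'
    · exact .refl hx
    · exact .of_adj hx hv h'.symm
  · rcases h y hy with rfl | h'
    · exact .refl hy
    · exact .of_adj hv hy h'

/-- `G` contains the image of a drawing of `K₅` in which disjoint edges have disjoint images. -/
def HasAlmostK5 (G : SimpleGraph V) : Prop :=
  ∃ (r : Fin 5 → V) (A : Fin 5 → Fin 5 → Set V),
    (∀ i j, i < j → G.JoinedWithin (A i j) (r i) (r j)) ∧
    ∀ i j k l, i < j → k < l → i ≠ k → i ≠ l → j ≠ k → j ≠ l → Disjoint (A i j) (A k l)

theorem hasAlmostK5_top : (⊤ : SimpleGraph (Fin 5)).HasAlmostK5 := by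
  refine ⟨id, fun i j => {i, j}, fun i j h => .of_adj (by simp) (by simp) h.ne, ?_⟩
  intro i j k l _ _ h1 h2 h3 h4
  simp [h1.symm, h2.symm, h3.symm, h4.symm]

theorem JoinedWithin.lift {G : SimpleGraph V} {H : SimpleGraph W} {S : W → Set V}
    (hconn : ∀ w, ∀ x ∈ S w, ∀ y ∈ S w, G.JoinedWithin (S w) x y)
    (hadj : ∀ w w', H.Adj w w' → ∃ x ∈ S w, ∃ y ∈ S w', G.Adj x y)
    {A : Set W} {a b : W} (h : H.JoinedWithin A a b) :
    ∀ x ∈ S a, ∀ y ∈ S b, G.JoinedWithin (⋃ w ∈ A, S w) x y := by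
  obtain ⟨ha, h⟩ := h
  induction h with
  | refl =>
    exact fun x hx y hy => (hconn a x hx y hy).mono (Set.subset_biUnion_of_mem ha)
  | @tail b c _ hbc ih =>
    intro x hx y hy
    obtain ⟨b', hb', c', hc', hbc'⟩ := hadj b c hbc.1
    have hsub : S c ⊆ ⋃ w ∈ A, S w := Set.subset_biUnion_of_mem hbc.2
    have h1 := ih x hx b' hb'
    exact h1.trans <| (JoinedWithin.of_adj h1.mem_right (hsub hc') hbc').trans <|
      (hconn c c' hc' y hy).mono hsub

/-- `HasAlmostK5` passes from a minor `H`, with branch sets `S`, to the graph. -/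
theorem HasAlmostK5.of_branchSets {G : SimpleGraph V} {H : SimpleGraph W} (S : W → Set V)
    (hne : ∀ w, (S w).Nonempty) (hdisj : ∀ w w', w ≠ w' → Disjoint (S w) (S w'))
    (hconn : ∀ w, ∀ x ∈ S w, ∀ y ∈ S w, G.JoinedWithin (S w) x y)
    (hadj : ∀ w w', H.Adj w w' → ∃ x ∈ S w, ∃ y ∈ S w', G.Adj x y)
    (h : H.HasAlmostK5) : G.HasAlmostK5 := by
  obtain ⟨r, A, hj, hd⟩ := h
  choose f hf using hne
  refine ⟨fun i => f (r i), fun i j => ⋃ w ∈ A i j, S w,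
    fun i j hij => (hj i j hij).lift hconn hadj _ (hf _) _ (hf _), ?_⟩
  intro i j k l h1 h2 h3 h4 h5 h6
  have hA := hd i j k l h1 h2 h3 h4 h5 h6
  simp only [Set.disjoint_iUnion_left, Set.disjoint_iUnion_right]
  exact fun w' hw' w hw => hdisj _ _ fun e => Set.disjoint_left.1 hA hw (e ▸ hw')

theorem HasAlmostK5.mono {G H : SimpleGraph V} (hHG : H ≤ G) (h : H.HasAlmostK5) :
    G.HasAlmostK5 := by
  obtain ⟨r, A, hj, hd⟩ := h
  exact ⟨r, A, fun i j hij => ⟨(hj i j hij).1,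
    Relation.ReflTransGen.mono (fun _ _ h' => ⟨hHG h'.1, h'.2⟩) _ _ (hj i j hij).2⟩,
    hd⟩

end Almost

theorem IsPlanar.not_hasAlmostK5 {V : Type*} {G : SimpleGraph V} (hG : G.IsPlanar) :
    ¬ G.HasAlmostK5 := by
  obtain ⟨pos, arc, hinj, hcont, hend, -, -, hint, hcross⟩ := hG
  rintro ⟨r, A, hj, hd⟩
  let T : ℝ × ℝ → ℂ := Complex.equivRealProdCLM.symm
  have hT : Continuous T := Complex.equivRealProdCLM.symm.continuous
  have hTi : Function.Injective T := Complex.equivRealProdCLM.symm.injective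
  -- the part of the drawing spanned by a set of vertices
  let R : Set V → Set (ℝ × ℝ) := fun A => {z | (∃ a ∈ A, z = pos a) ∨
    ∃ u ∈ A, ∃ v ∈ A, ∃ (h : G.Adj u v) (s : unitInterval), s ≠ 0 ∧ s ≠ 1 ∧ z = arc h s}
  have harc : ∀ A : Set V, ∀ u ∈ A, ∀ v ∈ A, ∀ (h : G.Adj u v) (s : unitInterval),
      arc h s ∈ R A := by
    intro A u hu v hv h s
    by_cases h0 : s = 0
    · exact .inl ⟨u, hu, by rw [h0, (hend h).1]⟩
    by_cases h1 : s = 1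
    · exact .inl ⟨v, hv, by rw [h1, (hend h).2]⟩
    exact .inr ⟨u, hu, v, hv, h, s, h0, h1, rfl⟩
  have hRd : ∀ A B : Set V, Disjoint A B → Disjoint (R A) (R B) := by
    intro A B hAB
    have hne : ∀ a ∈ A, ∀ b ∈ B, a ≠ b := fun a ha b hb e => Set.disjoint_left.1 hAB ha (e ▸ hb)
    rw [Set.disjoint_left]
    rintro z (⟨a, ha, rfl⟩ | ⟨u, hu, v, hv, h, s, hs0, hs1, rfl⟩)
      (⟨b, hb, e⟩ | ⟨u', hu', v', hv', h', s', hs0', hs1', e⟩)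
    · exact hne a ha b hb (hinj e)
    · exact hint h' s' hs0' hs1' _ e.symm
    · exact hint h s hs0 hs1 _ e
    · exact hcross h h' (fun q => hne _ hu _ hu' q.1) (fun q => hne _ hu _ hv' q.1) s s'
        hs0 hs1 hs0' hs1' e
  have hRj : ∀ (A : Set V) x y, G.JoinedWithin A x y → JoinedIn (R A) (pos x) (pos y) := by
    rintro A x y ⟨hx, h⟩
    induction h with
    | refl => exact JoinedIn.refl (.inl ⟨x, hx, rfl⟩)
    | @tail b c hxb hbc ih =>
      have hb : b ∈ A := JoinedWithin.mem_right ⟨hx, hxb⟩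
      exact ih.trans ⟨⟨⟨arc hbc.1, hcont hbc.1⟩, (hend hbc.1).1, (hend hbc.1).2⟩,
        fun s => harc A b hb c hbc.2 hbc.1 s⟩
  have hpath : ∀ i j, ∃ γ : ℝ → ℂ, i < j → Continuous γ ∧ γ 0 = T (pos (r i)) ∧
      γ 1 = T (pos (r j)) ∧ ∀ t, ∃ z ∈ R (A i j), γ t = T z := by
    intro i j
    by_cases hij : i < j
    · obtain ⟨γ, hγ⟩ := hRj _ _ _ (hj i j hij)
      refine ⟨fun t => T (γ.extend t), fun _ => ⟨hT.comp γ.continuous_extend, by simp, by simp,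
        fun t => ⟨_, ?_, rfl⟩⟩⟩
      exact hγ _
    · exact ⟨0, fun h => absurd h hij⟩
  choose γ hγ using hpath
  have hmem : ∀ m k l, k < l → m ≠ k → m ≠ l → pos (r m) ∉ R (A k l) := by
    intro m k l hkl hmk hml hmem
    obtain ⟨x, hx1, hx2, hx3⟩ : ∃ x : Fin 5, x ≠ m ∧ x ≠ k ∧ x ≠ l := by
      clear hmem; decide +revert
    rcases lt_or_gt_of_ne hx1 with h | h
    · exact Set.disjoint_left.1 (hRd _ _ (hd x m k l h hkl hx2 hx3 hmk hml))
        (.inl ⟨_, (hj x m h).mem_right, rfl⟩) hmem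
    · exact Set.disjoint_left.1 (hRd _ _ (hd m x k l h hkl hmk hml hx2 hx3))
        (.inl ⟨_, (hj m x h).1, rfl⟩) hmem
  refine exists_crossing_of_complete_five (fun i => T (pos (r i))) γ (fun i j h => (hγ i j h).1)
    (fun i j h => (hγ i j h).2.1) (fun i j h => (hγ i j h).2.2.1) ?_ ?_
  · intro m k l hkl hmk hml t e
    obtain ⟨z, hz, hz'⟩ := (hγ k l hkl).2.2.2 t
    exact hmem m k l hkl hmk hml (hTi (e.trans hz') ▸ hz)
  · intro i j k l hij hkl h1 h2 h3 h4 s t e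
    obtain ⟨z, hz, hz'⟩ := (hγ i j hij).2.2.2 s
    obtain ⟨y, hy, hy'⟩ := (hγ k l hkl).2.2.2 t
    exact Set.disjoint_left.1 (hRd _ _ (hd i j k l hij hkl h1 h2 h3 h4)) hz
      (hTi (hz'.symm.trans (e.trans hy')) ▸ hy)

end SimpleGraph

namespace SimpleGraph

section Minors

variable {V W : Type*}

/-- `HasAlmostK5` passes from a minor, all of whose branch sets but one are singletons. -/
theorem HasAlmostK5.of_branchSet {G : SimpleGraph V} {H : SimpleGraph W} (f : W → V)
    (hf : Function.Injective f) (a : W) (T : Set V) (hT : ∀ x, f x ∉ T)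
    (hconn : ∀ x ∈ insert (f a) T, ∀ y ∈ insert (f a) T, G.JoinedWithin (insert (f a) T) x y)
    (hadj : ∀ x y, x ≠ a → y ≠ a → H.Adj x y → G.Adj (f x) (f y))
    (hadj' : ∀ y, H.Adj a y → ∃ t ∈ insert (f a) T, G.Adj t (f y))
    (h : H.HasAlmostK5) : G.HasAlmostK5 := by
  classical
  refine h.of_branchSets (fun x => if x = a then insert (f a) T else {f x}) ?_ ?_ ?_ ?_
  · intro w
    split_ifs
    · exact ⟨_, Set.mem_insert _ _⟩
    · exact Set.singleton_nonempty _
  · intro w w' hw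
    have hfw := hf.ne hw
    split_ifs with h1 h2 h2
    · exact absurd (h1.trans h2.symm) hw
    · subst h1; simp [hT, hfw.symm]
    · subst h2; simp [hT, hfw]
    · simpa using hfw
  · intro w
    split_ifs
    · exact hconn
    · simp only [Set.mem_singleton_iff]
      rintro x rfl y rfl
      exact .refl rfl
  · intro w w' hw
    split_ifs with h1 h2 h2
    · exact absurd (h1.trans h2.symm) hw.ne
    · subst h1
      obtain ⟨t, ht, ht'⟩ := hadj' w' hw
      exact ⟨t, ht, _, rfl, ht'⟩
    · subst h2
      obtain ⟨t, ht, ht'⟩ := hadj' w hw.symm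
      exact ⟨_, rfl, t, ht, ht'.symm⟩
    · exact ⟨_, rfl, _, rfl, hadj _ _ h1 h2 hw⟩

/-- The star with centre `a` and leaves `M`. -/
def starGraphOn (a : W) (M : Set W) : SimpleGraph W := fromRel fun x y => x = a ∧ y ∈ M

/-- The graph obtained by identifying `b` with `a`. -/
def identify (H : SimpleGraph W) (a b : W) : SimpleGraph {x // x ≠ b} :=
  fromRel fun x y => H.Adj x y ∨ (x.1 = a ∧ H.Adj b y)

theorem HasAlmostK5.of_induce_sup_star {G : SimpleGraph V} {v : V} {a : ({v}ᶜ : Set V)}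
    {M : Set ({v}ᶜ : Set V)} (ha : G.Adj v a) (hM : ∀ m ∈ M, G.Adj v m)
    (h : (G.induce {v}ᶜ ⊔ starGraphOn a M).HasAlmostK5) : G.HasAlmostK5 := by
  refine h.of_branchSet Subtype.val Subtype.val_injective a {v} (fun x => x.2)
    (joinedWithin_of_hub (v := v) (by simp) (by simp [ha])) ?_ ?_
  · intro x y hx hy hxy
    simpa [starGraphOn, hx, hy] using hxy
  · intro y hy
    simp only [sup_adj, comap_adj, Function.Embedding.subtype_apply, starGraphOn, fromRel_adj] at hy
    rcases hy with hy | ⟨-, hy | hy⟩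
    · exact ⟨a, by simp, hy⟩
    · exact ⟨v, by simp, hM _ hy.2⟩
    · exact ⟨v, by simp, hy.1 ▸ ha⟩

theorem HasAlmostK5.of_identify {G : SimpleGraph V} {v : V} {a b : ({v}ᶜ : Set V)}
    {M : Set ({v}ᶜ : Set V)} (ha : G.Adj v a) (hb : G.Adj v b) (hab : a ≠ b)
    (hM : ∀ m ∈ M, G.Adj v m)
    (h : ((G.induce {v}ᶜ ⊔ starGraphOn a M).identify a b).HasAlmostK5) : G.HasAlmostK5 := by
  refine h.of_branchSet (fun x => x.1.1) (Subtype.val_injective.comp Subtype.val_injective)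
    ⟨a, hab⟩ {v, b.1} (fun x => ?_)
    (joinedWithin_of_hub (v := v) (by simp) (by simp [ha, hb])) ?_ ?_
  · simp only [Set.mem_insert_iff, Set.mem_singleton_iff, not_or]
    exact ⟨x.1.2, fun e => x.2 (Subtype.ext e)⟩
  · rintro x y hx hy ⟨-, hxy⟩
    have hx' : x.1 ≠ a := fun e => hx (Subtype.ext e)
    have hy' : y.1 ≠ a := fun e => hy (Subtype.ext e)
    simp only [hx', hy', false_and, or_false, sup_adj, starGraphOn, fromRel_adj, and_false] at hxy
    rcases hxy with h | h
    · exact h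
    · exact h.symm
  · rintro ⟨y, hy⟩ ⟨hne, hay⟩
    have key : ∀ z w : ({v}ᶜ : Set V), (z = a ∨ z = b) →
        (G.induce {v}ᶜ ⊔ starGraphOn a M).Adj z w →
        ∃ t ∈ (insert a.1 {v, b.1} : Set V), G.Adj t w := by
      rintro z w hz (h | ⟨-, h | h⟩)
      · exact ⟨z, by rcases hz with rfl | rfl <;> simp, h⟩
      · exact ⟨v, by simp, hM _ h.2⟩
      · exact ⟨v, by simp, h.1 ▸ ha⟩
    have hya : y ≠ a := fun e => hne (Subtype.ext e.symm)
    simp only [hya, false_and, or_false] at hay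
    rcases hay with (h | ⟨-, h⟩) | h
    · exact key _ _ (.inl rfl) h
    · exact key _ _ (.inr rfl) h
    · exact key _ _ (.inl rfl) h.symm

theorem HasAlmostK5.of_induce {G : SimpleGraph V} {s : Set V} (h : (G.induce s).HasAlmostK5) :
    G.HasAlmostK5 := by
  refine h.of_branchSets (fun x => {x.1}) (fun _ => Set.singleton_nonempty _) ?_ ?_ ?_
  · intro x y hxy
    simpa using fun e => hxy (Subtype.ext e)
  · simp only [Set.mem_singleton_iff]
    rintro w x rfl y rfl
    exact .refl rfl
  · exact fun x y hxy => ⟨x, rfl, y, rfl, hxy⟩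

theorem hasAlmostK5_of_isClique {G : SimpleGraph V} {v : V} {N : Finset V}
    (hN : ∀ x ∈ N, G.Adj v x) (hcard : 4 ≤ N.card) (hcl : G.IsClique (N : Set V)) :
    G.HasAlmostK5 := by
  classical
  have hv : v ∉ N := fun h => (hN v h).ne rfl
  have h5 : ¬ G.CliqueFree (N.card + 1) := fun h => h (insert v N)
    ⟨by simpa using hcl.insert fun x hx _ => hN x hx, Finset.card_insert_of_notMem hv⟩
  let f := topEmbeddingOfNotCliqueFree fun h => h5 (h.mono (Nat.succ_le_succ hcard))
  refine hasAlmostK5_top.of_branchSets (fun x => {f x}) (fun _ => Set.singleton_nonempty _) ?_ ?_ ?_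
  · intro x y hxy
    simpa using hxy
  · simp only [Set.mem_singleton_iff]
    rintro w x rfl y rfl
    exact .refl rfl
  · exact fun x y hxy => ⟨f x, rfl, f y, rfl, f.map_adj_iff.2 hxy⟩

theorem hasAlmostK5_of_wheel {G : SimpleGraph V} {v a b c d e : V} (hva : G.Adj v a)
    (hvb : G.Adj v b) (hvc : G.Adj v c) (hvd : G.Adj v d) (hve : G.Adj v e) (hab : a ≠ b)
    (hcd : c ≠ d) (hac : G.Adj a c) (had : G.Adj a d) (hae : G.Adj a e) (hbc : G.Adj b c)
    (hbd : G.Adj b d) (hbe : G.Adj b e) (hce : G.Adj c e) (hde : G.Adj d e) :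
    G.HasAlmostK5 := by
  have hadj : ∀ x y : Fin 5, x ≠ 0 → y ≠ 0 → x ≠ y →
      G.Adj (![a, b, d, e, v] x) (![a, b, d, e, v] y) := by
    intro x y hx hy hxy
    fin_cases x <;> fin_cases y <;>
      first
        | exact absurd rfl hx
        | exact absurd rfl hy
        | exact absurd rfl hxy
        | simp [hvb, hvd, hve, hbd, hbe, hde, hvb.symm, hvd.symm, hve.symm, hbd.symm, hbe.symm,
            hde.symm]
  refine hasAlmostK5_top.of_branchSet ![a, b, d, e, v] ?_ 0 {c} ?_ ?_ ?_ ?_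
  · have h0 : ∀ y : Fin 5, y ≠ 0 → a ≠ ![a, b, d, e, v] y := by
      intro y hy
      fin_cases y
      · exact absurd rfl hy
      · exact hab
      · exact had.ne
      · exact hae.ne
      · exact hva.ne'
    intro x y hxy
    by_contra hne
    by_cases hx : x = 0
    · subst hx; exact h0 y (Ne.symm hne) hxy
    by_cases hy : y = 0
    · subst hy; exact h0 x hne hxy.symm
    exact (hadj x y hx hy hne).ne hxy
  · intro x
    fin_cases x
    · exact hac.ne
    · exact hbc.ne
    · exact hcd.symm
    · exact hce.ne'
    · exact hvc.ne
  · exact joinedWithin_of_hub (v := a) (by simp) (by simp [hac])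
  · exact fun x y hx hy hxy => hadj x y hx hy hxy.ne
  · intro y hy
    have hy' : y ≠ 0 := hy.ne'
    fin_cases y
    · exact absurd rfl hy'
    · exact ⟨c, by simp, hbc.symm⟩
    · exact ⟨a, by simp, had⟩
    · exact ⟨a, by simp, hae⟩
    · exact ⟨a, by simp, hva.symm⟩

end Minors

section Degree

theorem exists_degree_le_five {V : Type*} [Fintype V] [Nonempty V] (G : SimpleGraph V)
    [DecidableRel G.Adj] (h : G.edgeFinset.card < 3 * Fintype.card V) : ∃ v, G.degree v ≤ 5 := by
  classical
  by_contra! hcon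
  have h1 := G.sum_degrees_eq_twice_card_edges
  have h2 : ∑ _v : V, 6 ≤ ∑ v, G.degree v := Finset.sum_le_sum fun v _ => hcon v
  simp at h2
  omega

theorem hasAlmostK5_of_neighbors {V : Type*} {G : SimpleGraph V} {v : V} {N : Finset V}
    (hN : ∀ x ∈ N, G.Adj v x) (hcard : N.card = 5)
    (h : ∀ u ∈ N, ∀ w ∈ N, ∀ w' ∈ N, u ≠ w → u ≠ w' → w ≠ w' → G.Adj u w ∨ G.Adj u w') :
    G.HasAlmostK5 := by
  classical
  by_cases hcl : G.IsClique (N : Set V)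
  · exact hasAlmostK5_of_isClique hN (by omega) hcl
  obtain ⟨a, ha, b, hb, hab, hnab⟩ : ∃ a ∈ N, ∃ b ∈ N, a ≠ b ∧ ¬ G.Adj a b := by
    simpa [IsClique, Set.Pairwise] using hcl
  have hadj : ∀ x ∈ N, x ≠ a → x ≠ b → G.Adj a x ∧ G.Adj b x := fun x hx hxa hxb =>
    ⟨(h a ha b hb x hx hab hxa.symm hxb.symm).resolve_left hnab,
      (h b hb a ha x hx hab.symm hxb.symm hxa.symm).resolve_left fun q => hnab q.symm⟩
  by_cases hcl' : G.IsClique ((N.erase a).erase b : Set V)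
  · refine hasAlmostK5_of_isClique (N := N.erase b) (v := v)
      (fun x hx => hN x (Finset.mem_of_mem_erase hx))
      (by rw [Finset.card_erase_of_mem hb]; omega) ?_
    have : (N.erase b : Set V) = insert a ((N.erase a).erase b : Set V) := by
      ext x
      by_cases hx : x = a <;> simp [hx, ha, hab]
    rw [this]
    refine hcl'.insert fun x hx _ => ?_
    have hx' : x ≠ b ∧ x ≠ a ∧ x ∈ N := by simpa [and_assoc, and_comm, and_left_comm] using hx
    exact (hadj x hx'.2.2 hx'.2.1 hx'.1).1
  obtain ⟨c, hc, d, hd, hcd, hncd⟩ : ∃ c ∈ (N.erase a).erase b, ∃ d ∈ (N.erase a).erase b,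
      c ≠ d ∧ ¬ G.Adj c d := by
    simpa only [IsClique, Set.Pairwise, not_forall, exists_prop, ← Finset.coe_erase,
      Finset.mem_coe] using hcl'
  obtain ⟨e, he⟩ : (((N.erase a).erase b) \ {c, d}).Nonempty := by
    rw [← Finset.card_pos, Finset.card_sdiff_of_subset (by simp_all [Finset.insert_subset_iff]),
      Finset.card_pair hcd,
      Finset.card_erase_of_mem (by simp [hb, hab.symm]), Finset.card_erase_of_mem ha]
    omega
  simp only [Finset.mem_sdiff, Finset.mem_erase, Finset.mem_insert, Finset.mem_singleton,
    not_or] at hc hd he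
  obtain ⟨⟨heb, hea, he⟩, hec, hed⟩ := he
  obtain ⟨hcb, hca, hc⟩ := hc
  obtain ⟨hdb, hda, hd⟩ := hd
  refine hasAlmostK5_of_wheel (hN a ha) (hN b hb) (hN c hc) (hN d hd) (hN e he) hab hcd
    (hadj c hc hca hcb).1 (hadj d hd hda hdb).1 (hadj e he hea heb).1
    (hadj c hc hca hcb).2 (hadj d hd hda hdb).2 (hadj e he hea heb).2
    ((h c hc d hd e he hcd (Ne.symm hec) (Ne.symm hed)).resolve_left hncd)
    ((h d hd c hc e he hcd.symm (Ne.symm hed) (Ne.symm hec)).resolve_left fun q => hncd q.symm)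

theorem card_edgeFinset_induce_compl_add_degree {V : Type*} [Fintype V] (G : SimpleGraph V)
    [DecidableRel G.Adj] [DecidableEq V] (v : V) :
    (G.induce {v}ᶜ).edgeFinset.card + G.degree v = G.edgeFinset.card := by
  have h : G.degree v ≤ G.edgeFinset.card := by
    rw [← card_incidenceFinset_eq_degree]
    exact Finset.card_le_card (G.incidenceFinset_subset v)
  rw [card_edgeFinset_induce_compl_singleton, card_edgeFinset_deleteIncidenceSet]
  omega

theorem card_edgeFinset_add_two_le {n : ℕ} : ∀ {V : Type} [Fintype V] (G : SimpleGraph V)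
    [DecidableRel G.Adj], Fintype.card V = n → 0 < n → ¬ G.HasAlmostK5 →
    G.edgeFinset.card + 2 ≤ 3 * n := by
  induction n using Nat.strong_induction_on with
  | _ n ihn =>
  intro V _ G _ hn hpos hG
  classical
  obtain ⟨m, hm⟩ : ∃ m, G.edgeFinset.card = m := ⟨_, rfl⟩
  induction m generalizing G with
  | zero => omega
  | succ m ihm =>
  obtain ⟨e, he⟩ : G.edgeFinset.Nonempty := by
    rw [← Finset.card_pos]; omega
  have hdel : (G.deleteEdges {e}).edgeFinset.card = m := by
    have : (G.deleteEdges {e}).edgeFinset = G.edgeFinset.erase e := by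
      ext x; simp [and_comm]
    rw [this, Finset.card_erase_of_mem he, hm]
    rfl
  have hlt := ihm (G.deleteEdges {e}) (fun h => hG (h.mono (G.deleteEdges_le _))) hdel
  have : Nonempty V := Fintype.card_pos_iff.1 (by omega)
  obtain ⟨v, hv⟩ := G.exists_degree_le_five (by omega)
  have hn1 : 1 < n := by
    induction e with | _ x y
    rw [mem_edgeFinset, mem_edgeSet] at he
    rw [← hn]
    exact Fintype.one_lt_card_iff.2 ⟨x, y, he.ne⟩
  have hcard : Fintype.card ({v}ᶜ : Set V) = n - 1 := by
    rw [Fintype.card_compl_set, hn]; simp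
  have hdeg := G.card_edgeFinset_induce_compl_add_degree v
  have hminor : ∀ (a : ({v}ᶜ : Set V)) (M : Set ({v}ᶜ : Set V)), G.Adj v a →
      (∀ m ∈ M, G.Adj v m) → (G.induce {v}ᶜ ⊔ starGraphOn a M).edgeFinset.card + 2 ≤ 3 * (n - 1) :=
    fun a M ha hM => by
      have := ihn (n - 1) (by omega) (G.induce {v}ᶜ ⊔ starGraphOn a M) hcard (by omega)
        fun h => hG (h.of_induce_sup_star ha hM)
      convert this
  have hNdeg : (G.neighborFinset v).card = G.degree v := rfl
  have hmemN : ∀ x, x ∈ G.neighborFinset v ↔ G.Adj v x := fun x => by simp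
  rcases Nat.lt_or_ge (G.degree v) 4 with h3 | h4
  · have := ihn (n - 1) (by omega) (G.induce {v}ᶜ) hcard (by omega) fun h => hG h.of_induce
    omega
  rcases h4.eq_or_lt with h4 | h5
  · by_contra hlarge
    refine hG (hasAlmostK5_of_isClique (N := G.neighborFinset v) (v := v) (by simp) (by omega) ?_)
    intro u hu w hw huw
    by_contra hnuw
    simp only [Finset.mem_coe, hmemN] at hu hw
    have huw' : (⟨u, hu.ne'⟩ : ({v}ᶜ : Set V)) ≠ ⟨w, hw.ne'⟩ := fun e => huw (congrArg (·.1) e)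
    have := hminor ⟨u, hu.ne'⟩ {⟨w, hw.ne'⟩} hu (by simpa using hw)
    have hsub : (G.induce {v}ᶜ ⊔ edge ⟨u, hu.ne'⟩ ⟨w, hw.ne'⟩).edgeFinset.card ≤
        (G.induce {v}ᶜ ⊔ starGraphOn ⟨u, hu.ne'⟩ {⟨w, hw.ne'⟩}).edgeFinset.card := by
      refine Finset.card_le_card (edgeFinset_mono (sup_le_sup_left ?_ _))
      rw [edge_le_iff]
      right
      simp [starGraphOn, huw']
    rw [card_edgeFinset_sup_edge _ (by simpa using hnuw) huw'] at hsub
    omega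
  · have h5 : G.degree v = 5 := by omega
    by_contra hlarge
    refine hG (hasAlmostK5_of_neighbors (N := G.neighborFinset v) (v := v) (by simp) (by omega) ?_)
    intro u hu w hw w' hw' huw huw' hww'
    by_contra! hnuw
    simp only [hmemN] at hu hw hw'
    have e₁ : (⟨u, hu.ne'⟩ : ({v}ᶜ : Set V)) ≠ ⟨w, hw.ne'⟩ := fun e => huw (congrArg (·.1) e)
    have e₂ : (⟨u, hu.ne'⟩ : ({v}ᶜ : Set V)) ≠ ⟨w', hw'.ne'⟩ := fun e => huw' (congrArg (·.1) e)
    have e₃ : (⟨w, hw.ne'⟩ : ({v}ᶜ : Set V)) ≠ ⟨w', hw'.ne'⟩ := fun e => hww' (congrArg (·.1) e)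
    have := hminor ⟨u, hu.ne'⟩ {⟨w, hw.ne'⟩, ⟨w', hw'.ne'⟩} hu (by simpa using ⟨hw, hw'⟩)
    obtain ⟨K, hK⟩ : ∃ K, K = G.induce {v}ᶜ ⊔ edge ⟨u, hu.ne'⟩ ⟨w, hw.ne'⟩ := ⟨_, rfl⟩
    have hK1 : K.edgeFinset.card = (G.induce {v}ᶜ).edgeFinset.card + 1 := by
      subst hK
      convert card_edgeFinset_sup_edge (G.induce {v}ᶜ) (by simpa using hnuw.1) e₁
    have hK2 : ¬ K.Adj ⟨u, hu.ne'⟩ ⟨w', hw'.ne'⟩ := by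
      simp [hK, edge_adj, hnuw.2, e₂, e₂.symm, e₃.symm]
    have hsub : (K ⊔ edge ⟨u, hu.ne'⟩ ⟨w', hw'.ne'⟩).edgeFinset.card ≤
        (G.induce {v}ᶜ ⊔ starGraphOn ⟨u, hu.ne'⟩ {⟨w, hw.ne'⟩, ⟨w', hw'.ne'⟩}).edgeFinset.card := by
      refine Finset.card_le_card (edgeFinset_mono ?_)
      rw [hK, sup_assoc]
      refine sup_le_sup_left (sup_le ?_ ?_) _ <;>
      · rw [edge_le_iff]
        right
        simp [starGraphOn, e₁, e₂]
    rw [card_edgeFinset_sup_edge _ hK2 e₂, hK1] at hsub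
    omega

end Degree

end SimpleGraph

section PolyValued

/-- The function `F` agrees on the positive integers with a real polynomial whose values on
`[5, ∞)` lie in `S`. -/
def PolyValued (S : Set ℝ) (F : ℕ → ℝ) : Prop :=
  ∃ P : ℝ[X], (∀ n : ℕ, 0 < n → P.eval (n : ℝ) = F n) ∧ ∀ t : ℝ, 5 ≤ t → P.eval t ∈ S

namespace PolyValued

variable {S T : Set ℝ} {F F' : ℕ → ℝ}

theorem mono (hST : S ⊆ T) (h : PolyValued S F) : PolyValued T F :=
  let ⟨P, hP, hP'⟩ := h
  ⟨P, hP, fun t ht => hST (hP' t ht)⟩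

theorem congr (h : PolyValued S F) (hF : ∀ n, F' n = F n) : PolyValued S F' :=
  (funext hF : F' = F) ▸ h

theorem const {x : ℝ} (hx : x ∈ S) : PolyValued S fun _ => x :=
  ⟨C x, by simp, by simpa using fun _ _ => hx⟩

theorem add {U : Set ℝ} (hU : ∀ x ∈ S, ∀ y ∈ T, x + y ∈ U) (h : PolyValued S F)
    (h' : PolyValued T F') : PolyValued U fun n => F n + F' n := by
  obtain ⟨P, hP, hP'⟩ := h
  obtain ⟨Q, hQ, hQ'⟩ := h'
  refine ⟨P + Q, fun n hn => by rw [eval_add, hP n hn, hQ n hn], fun t ht => ?_⟩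
  rw [eval_add]
  exact hU _ (hP' t ht) _ (hQ' t ht)

theorem nonneg_add_nonneg (h : PolyValued (Set.Ici 0) F) (h' : PolyValued (Set.Ici 0) F') :
    PolyValued (Set.Ici 0) fun n => F n + F' n :=
  h.add (fun _ hx _ hy => Set.mem_Ici.2 (add_nonneg hx hy)) h'

theorem pos_add_nonneg (h : PolyValued (Set.Ioi 0) F) (h' : PolyValued (Set.Ici 0) F') :
    PolyValued (Set.Ioi 0) fun n => F n + F' n :=
  h.add (fun _ hx _ hy => Set.mem_Ioi.2 (add_pos_of_pos_of_nonneg hx hy)) h'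

theorem nonneg_add_pos (h : PolyValued (Set.Ici 0) F) (h' : PolyValued (Set.Ioi 0) F') :
    PolyValued (Set.Ioi 0) fun n => F n + F' n :=
  h.add (fun _ hx _ hy => Set.mem_Ioi.2 (add_pos_of_nonneg_of_pos hx hy)) h'

theorem natCast_sub_mul (k : ℕ) (hU : ∀ t : ℝ, 5 ≤ t → ∀ x ∈ S, (t - k) * x ∈ T)
    (h : PolyValued S F) : PolyValued T fun n => ((n : ℝ) - k) * F n := by
  obtain ⟨P, hP, hP'⟩ := h
  refine ⟨(X - C (k : ℝ)) * P, fun n hn => by simp [hP n hn], fun t ht => ?_⟩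
  simpa using hU t ht _ (hP' t ht)

end PolyValued

end PolyValued

namespace SimpleGraph

open Finset

/-- The proper colourings of `H` with colours in `Fin n`. -/
noncomputable def properColorings {W : Type} [Finite W] (H : SimpleGraph W) (n : ℕ) :
    Finset (W → Fin n) :=
  (Set.toFinite {c : W → Fin n | ∀ x y, H.Adj x y → c x ≠ c y}).toFinset

theorem starGraphOn_empty {W : Type*} (a : W) : starGraphOn a ∅ = ⊥ := by
  ext
  simp [starGraphOn]

section Colorings

variable {V W : Type} [Fintype V] [Finite W] {n : ℕ}

theorem mem_properColorings {H : SimpleGraph W} {c : W → Fin n} :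
    c ∈ H.properColorings n ↔ ∀ x y, H.Adj x y → c x ≠ c y := by
  simp [properColorings]

theorem card_properColorings (H : SimpleGraph W) (n : ℕ) :
    #(H.properColorings n) = Nat.card (H.Coloring (Fin n)) := by
  rw [← Nat.card_eq_finsetCard]
  exact Nat.card_congr
    { toFun c := Coloring.mk c.1 fun {x y} h => mem_properColorings.1 c.2 x y h
      invFun f := ⟨f, mem_properColorings.2 fun _ _ h => f.valid h⟩
      left_inv _ := rfl
      right_inv _ := rfl }

theorem mem_properColorings_sup_star {H : SimpleGraph W} {a : W} {M : Set W} {c : W → Fin n} :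
    c ∈ (H ⊔ starGraphOn a M).properColorings n ↔
      c ∈ H.properColorings n ∧ ∀ x ∈ M, x ≠ a → c a ≠ c x := by
  simp only [mem_properColorings, sup_adj, starGraphOn, fromRel_adj]
  constructor
  · exact fun h => ⟨fun x y hxy => h x y (.inl hxy),
      fun x hx hxa => h a x (.inr ⟨hxa.symm, .inl ⟨rfl, hx⟩⟩)⟩
  · rintro ⟨h, h'⟩ x y (hxy | ⟨hne, ⟨rfl, hy⟩ | ⟨rfl, hx⟩⟩)
    · exact h x y hxy
    · exact h' y hy hne.symm
    · exact (h' x hx hne).symm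

open scoped Classical in
theorem card_properColorings_eq_sum (G : SimpleGraph V) (v : V) (n : ℕ) :
    (#(G.properColorings n) : ℝ) = ∑ c ∈ (G.induce {v}ᶜ).properColorings n,
      ((n : ℝ) - #((univ.filter fun x : ({v}ᶜ : Set V) => G.Adj v x).image c)) := by
  have hmaps : ∀ c ∈ G.properColorings n,
      (fun x : ({v}ᶜ : Set V) => c x) ∈ (G.induce {v}ᶜ).properColorings n := fun c hc =>
    mem_properColorings.2 fun x y hxy => mem_properColorings.1 hc x y hxy
  rw [card_eq_sum_card_fiberwise hmaps, Nat.cast_sum]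
  refine sum_congr rfl fun c hc => ?_
  have hle := card_le_univ ((univ.filter fun x : ({v}ᶜ : Set V) => G.Adj v x).image c)
  have hcompl := card_compl ((univ.filter fun x : ({v}ᶜ : Set V) => G.Adj v x).image c)
  rw [Fintype.card_fin] at hle hcompl
  rw [← Nat.cast_sub hle, ← hcompl]
  congr 1
  refine card_nbij' (fun c' => c' v) (fun k x => if h : x = v then k else c ⟨x, h⟩) ?_ ?_ ?_ ?_
  · intro c' hc'
    simp only [coe_filter, Set.mem_ofPred_eq, mem_properColorings] at hc'
    obtain ⟨hc', rfl⟩ := hc'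
    simpa using fun x hx _ => (hc' v x hx).symm
  · intro k hk
    replace hk : ∀ x (hx : x ≠ v), G.Adj v x → c ⟨x, hx⟩ ≠ k := fun x hx h => by
      simp at hk
      exact hk x h hx
    simp only [coe_filter, Set.mem_ofPred_eq, mem_properColorings]
    refine ⟨fun x y hxy => ?_, ?_⟩
    · by_cases hx : x = v
      · subst hx
        simpa [hxy.ne'] using (hk y hxy.ne' hxy).symm
      · by_cases hy : y = v
        · subst hy
          simpa [hx] using hk x hx hxy.symm
        · simpa [hx, hy] using mem_properColorings.1 hc ⟨x, hx⟩ ⟨y, hy⟩ hxy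
    · ext x
      have : x.1 ≠ v := x.2
      simp [this]
  · intro c' hc'
    simp only [coe_filter, Set.mem_ofPred_eq] at hc'
    obtain ⟨-, rfl⟩ := hc'
    ext x
    by_cases hx : x = v <;> simp [hx]
  · intro k _
    simp

open scoped Classical in
theorem card_filter_eq_card_identify (K : SimpleGraph W) {a b : W} (hab : a ≠ b)
    (hK : ¬ K.Adj a b) (n : ℕ) :
    #{c ∈ K.properColorings n | c a = c b} = #((K.identify a b).properColorings n) := by
  refine card_nbij' (fun c x => c x) (fun d x => if h : x = b then d ⟨a, hab⟩ else d ⟨x, h⟩)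
    ?_ ?_ ?_ ?_
  · intro c hc
    simp only [coe_filter, Set.mem_ofPred_eq, mem_properColorings] at hc
    obtain ⟨hc, hcab⟩ := hc
    simp only [mem_coe, mem_properColorings, identify, fromRel_adj]
    rintro x y ⟨-, (h | ⟨h, h'⟩) | h | ⟨h, h'⟩⟩
    · exact hc _ _ h
    · rw [h, hcab]; exact hc _ _ h'
    · exact hc _ _ h.symm
    · rw [h, hcab]; exact (hc _ _ h').symm
  · intro d hd
    simp only [mem_coe, mem_properColorings] at hd
    simp only [coe_filter, Set.mem_ofPred_eq, mem_properColorings]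
    have hb : ∀ y (hy : y ≠ b), K.Adj b y → d ⟨a, hab⟩ ≠ d ⟨y, hy⟩ := fun y hy h =>
      hd _ _ ⟨fun e => hK <| by
        obtain rfl : a = y := congrArg Subtype.val e
        exact h.symm, .inl (.inr ⟨rfl, h⟩)⟩
    refine ⟨fun x y hxy => ?_, by simp [hab]⟩
    by_cases hx : x = b
    · subst hx
      simpa [hxy.ne'] using hb y hxy.ne' hxy
    · by_cases hy : y = b
      · subst hy
        simpa [hx] using (hb x hx hxy.symm).symm
      · simpa [hx, hy] using hd ⟨x, hx⟩ ⟨y, hy⟩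
          ⟨fun e => hxy.ne (congrArg Subtype.val e), .inl (.inl hxy)⟩
  · intro c hc
    simp only [coe_filter, Set.mem_ofPred_eq] at hc
    ext x
    by_cases hx : x = b <;> simp [hx, hc.2]
  · intro d _
    ext x
    simp [x.2]

open scoped Classical in
theorem card_filter_eq_zero_of_adj (K : SimpleGraph W) {a b : W} (hK : K.Adj a b) (n : ℕ) :
    #{c ∈ K.properColorings n | c a = c b} = 0 := by
  rw [card_eq_zero, filter_eq_empty_iff]
  exact fun c hc => mem_properColorings.1 hc a b hK

open scoped Classical in
theorem card_filter_exists_insert (H : SimpleGraph W) {a b : W} (hab : a ≠ b) (M : Set W)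
    (L : Finset W) (n : ℕ) :
    #{c ∈ (H ⊔ starGraphOn a M).properColorings n | ∃ x ∈ insert b L, c a = c x} =
      #{c ∈ (H ⊔ starGraphOn a M).properColorings n | c a = c b} +
      #{c ∈ (H ⊔ starGraphOn a (insert b M)).properColorings n | ∃ x ∈ L, c a = c x} := by
  rw [← card_union_of_disjoint (Finset.disjoint_left.2 ?_)]
  · congr 1
    ext c
    simp only [mem_union, mem_filter, mem_properColorings_sup_star, mem_insert,
      Set.mem_insert_iff, exists_eq_or_imp, forall_eq_or_imp]
    have := hab.symm
    tauto
  · intro c hc hc'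
    simp only [mem_filter, mem_properColorings_sup_star] at hc hc'
    exact hc'.1.2 b (Set.mem_insert _ _) hab.symm hc.2

open scoped Classical in
theorem sum_card_sub_card_image_insert {W : Type} (S : Finset (W → Fin n)) {a : W} {M : Finset W}
    (ha : a ∉ M) :
    ∑ c ∈ S, ((#(insert a M) : ℝ) - #((insert a M).image c)) =
      ∑ c ∈ S, ((#M : ℝ) - #(M.image c)) + #{c ∈ S | ∃ x ∈ M, c a = c x} := by
  rw [card_filter, Nat.cast_sum, ← sum_add_distrib]
  refine sum_congr rfl fun c _ => ?_
  rw [card_insert_of_notMem ha, image_insert]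
  split_ifs with h
  · obtain ⟨x, hx, hx'⟩ := h
    rw [insert_eq_of_mem (mem_image.2 ⟨x, hx, hx'.symm⟩)]
    push_cast
    ring
  · rw [card_insert_of_notMem fun h' => h (by simpa [eq_comm] using h')]
    push_cast
    ring

open scoped Classical in
theorem polyValued_card_filter_exists (H : SimpleGraph W) {a : W} {N : Finset W}
    (hN : ∀ b ∈ N, b ≠ a → ∀ M : Set W, M ⊆ N →
      PolyValued (Set.Ioi 0) fun n => #(((H ⊔ starGraphOn a M).identify a b).properColorings n))
    (L : Finset W) (hL : L ⊆ N.erase a) (M : Set W) (hM : M ⊆ N) :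
    PolyValued (Set.Ici 0) fun n =>
      #{c ∈ (H ⊔ starGraphOn a M).properColorings n | ∃ x ∈ L, c a = c x} := by
  induction L using Finset.induction_on generalizing M with
  | empty => simpa using PolyValued.const (Set.mem_Ici.2 le_rfl)
  | insert b L hb ih =>
    rw [insert_subset_iff, mem_erase] at hL
    obtain ⟨⟨hba, hbN⟩, hL⟩ := hL
    refine (PolyValued.nonneg_add_nonneg ?_
      (ih hL (insert b M) (Set.insert_subset hbN hM))).congr
        fun n => by rw [card_filter_exists_insert H hba.symm, Nat.cast_add]
    by_cases hab : (H ⊔ starGraphOn a M).Adj a b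
    · refine (PolyValued.const (Set.mem_Ici.2 le_rfl)).congr fun n => ?_
      rw [card_filter_eq_zero_of_adj _ hab, Nat.cast_zero]
    · refine ((hN b hbN hba M hM).mono Set.Ioi_subset_Ici_self).congr fun n => ?_
      rw [card_filter_eq_card_identify _ hba.symm hab]

open scoped Classical in
theorem polyValued_sum_card_sub_card_image (H : SimpleGraph W) {N : Finset W}
    (hN : ∀ a ∈ N, ∀ b ∈ N, b ≠ a → ∀ M : Set W, M ⊆ N →
      PolyValued (Set.Ioi 0) fun n => #(((H ⊔ starGraphOn a M).identify a b).properColorings n))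
    (L : Finset W) (hL : L ⊆ N) :
    PolyValued (Set.Ici 0) fun n =>
      ∑ c ∈ H.properColorings n, ((#L : ℝ) - #(L.image c)) := by
  induction L using Finset.induction_on with
  | empty => simpa using PolyValued.const (Set.mem_Ici.2 le_rfl)
  | insert a L ha ih =>
    rw [insert_subset_iff] at hL
    refine (PolyValued.nonneg_add_nonneg (ih hL.2)
      (polyValued_card_filter_exists H (hN a hL.1) L
        (fun x hx => mem_erase.2 ⟨fun e => ha (e ▸ hx), hL.2 hx⟩) ∅ (Set.empty_subset _))).congr
        fun n => ?_
    rw [sum_card_sub_card_image_insert _ ha]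
    rw [starGraphOn_empty, sup_bot_eq]

open scoped Classical in
theorem polyValued_sum_card_sub_card_image_of_not_adj (H : SimpleGraph W) {N : Finset W}
    (hN : ∀ a ∈ N, ∀ b ∈ N, b ≠ a → ∀ M : Set W, M ⊆ N →
      PolyValued (Set.Ioi 0) fun n => #(((H ⊔ starGraphOn a M).identify a b).properColorings n))
    {a b : W} (ha : a ∈ N) (hb : b ∈ N) (hab : a ≠ b) (hH : ¬ H.Adj a b) :
    PolyValued (Set.Ioi 0) fun n =>
      ∑ c ∈ H.properColorings n, ((#N : ℝ) - #(N.image c)) := by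
  have hstar : H ⊔ starGraphOn a ∅ = H := by rw [starGraphOn_empty, sup_bot_eq]
  have hb' : b ∈ N.erase a := mem_erase.2 ⟨hab.symm, hb⟩
  have h₁ := hN a ha b hb hab.symm ∅ (Set.empty_subset _)
  rw [hstar] at h₁
  have h₂ := polyValued_card_filter_exists H (hN a ha) ((N.erase a).erase b) (erase_subset _ _)
    {b} (by simpa using hb)
  have h₃ := polyValued_sum_card_sub_card_image H hN (N.erase a) (erase_subset _ _)
  refine (h₃.nonneg_add_pos (h₁.pos_add_nonneg h₂)).congr fun n => ?_
  have h₄ := sum_card_sub_card_image_insert (H.properColorings n) (notMem_erase a N)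
  have h₅ := card_filter_exists_insert H hab ∅ ((N.erase a).erase b) n
  rw [insert_erase ha] at h₄
  rw [insert_erase hb', hstar, card_filter_eq_card_identify _ hab hH, insert_empty_eq] at h₅
  rw [h₄, h₅, Nat.cast_add]

end Colorings

theorem polyValued_card_properColorings {k : ℕ} : ∀ {V : Type} [Fintype V] (G : SimpleGraph V),
    Fintype.card V = k → ¬ G.HasAlmostK5 →
    PolyValued (Set.Ioi 0) fun n => #(G.properColorings n) := by
  induction k using Nat.strong_induction_on with
  | _ k ih =>
  intro V _ G hk hG
  classical
  rcases k.eq_zero_or_pos with rfl | hpos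
  · have := Fintype.card_eq_zero_iff.1 hk
    refine (PolyValued.const (Set.mem_Ioi.2 one_pos)).congr fun n => ?_
    have : G.properColorings n = univ := by
      refine eq_univ_of_forall fun c => mem_properColorings.2 fun x => isEmptyElim x
    simp [this]
  have : Nonempty V := Fintype.card_pos_iff.1 (by omega)
  have hedge := G.card_edgeFinset_add_two_le hk hpos hG
  obtain ⟨v, hv⟩ := G.exists_degree_le_five (by omega)
  have hcard : Fintype.card ({v}ᶜ : Set V) = k - 1 := by
    rw [Fintype.card_compl_set, hk]; simp
  have hH := ih (k - 1) (by omega) (G.induce {v}ᶜ) hcard fun h => hG h.of_induce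
  obtain ⟨N, hNdef⟩ : ∃ N : Finset ({v}ᶜ : Set V),
      N = univ.filter fun x : ({v}ᶜ : Set V) => G.Adj v x := ⟨_, rfl⟩
  have hmem : ∀ x : ({v}ᶜ : Set V), x ∈ N ↔ G.Adj v x := by simp [hNdef]
  have hmap : N.map ⟨Subtype.val, Subtype.val_injective⟩ = G.neighborFinset v := by
    ext x
    simpa [hmem] using fun h : G.Adj v x => h.ne'
  have hNcard : #N = G.degree v := by rw [← card_neighborFinset_eq_degree, ← hmap, card_map]
  have hN : ∀ a ∈ N, ∀ b ∈ N, b ≠ a → ∀ M : Set ({v}ᶜ : Set V), M ⊆ N → PolyValued (Set.Ioi 0)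
      fun n => #(((G.induce {v}ᶜ ⊔ starGraphOn a M).identify a b).properColorings n) := by
    intro a ha b hb hba M hM
    refine ih (Fintype.card {x : ({v}ᶜ : Set V) // x ≠ b}) ?_ _ rfl fun h =>
      hG (h.of_identify ((hmem a).1 ha) ((hmem b).1 hb) hba.symm fun m hm => (hmem m).1 (hM hm))
    have := Fintype.card_subtype_lt (p := fun x : ({v}ᶜ : Set V) => x ≠ b) (x := b) (by simp)
    omega
  have hsplit : ∀ n : ℕ, (#(G.properColorings n) : ℝ) =
      ((n : ℝ) - #N) * #((G.induce {v}ᶜ).properColorings n) +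
        ∑ c ∈ (G.induce {v}ᶜ).properColorings n, ((#N : ℝ) - #(N.image c)) := fun n => by
    rw [card_properColorings_eq_sum G v, ← hNdef, mul_comm, ← nsmul_eq_mul, ← sum_const,
      ← sum_add_distrib]
    exact sum_congr rfl fun c _ => by ring
  rcases Nat.lt_or_ge #N 5 with h4 | h5
  · have h4' : (#N : ℝ) < 5 := by exact_mod_cast h4
    have h₁ := hH.natCast_sub_mul (T := Set.Ioi 0) #N fun t ht x hx =>
      Set.mem_Ioi.2 (mul_pos (by linarith) (Set.mem_Ioi.1 hx))
    have h₂ := polyValued_sum_card_sub_card_image _ hN N (Subset.refl N)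
    exact (h₁.pos_add_nonneg h₂).congr fun n => by rw [hsplit n]
  · have h5' : #N = 5 := by omega
    obtain ⟨a, ha, b, hb, hab, hnab⟩ :
        ∃ a ∈ N, ∃ b ∈ N, a ≠ b ∧ ¬ (G.induce {v}ᶜ).Adj a b := by
      by_contra! hcon
      refine hG (hasAlmostK5_of_isClique (N := G.neighborFinset v) (v := v) (by simp)
        (by rw [card_neighborFinset_eq_degree]; omega) ?_)
      rw [← hmap]
      intro x hx y hy hxy
      simp only [coe_map, Function.Embedding.coeFn_mk, Set.mem_image, mem_coe] at hx hy
      obtain ⟨x, hx, rfl⟩ := hx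
      obtain ⟨y, hy, rfl⟩ := hy
      exact hcon x hx y hy fun e => hxy (congrArg Subtype.val e)
    have h5r : (#N : ℝ) = 5 := by exact_mod_cast h5'
    have h₁ := hH.natCast_sub_mul (T := Set.Ici 0) #N fun t ht x hx =>
      Set.mem_Ici.2 (mul_nonneg (by linarith) (Set.mem_Ioi.1 hx).le)
    have h₂ := polyValued_sum_card_sub_card_image_of_not_adj _ hN ha hb hab hnab
    exact (h₁.nonneg_add_pos h₂).congr fun n => by rw [hsplit n]

end SimpleGraph

/-- Birkhoff–Lewis: every finite simple planar graph satisfies `P(G,t) > 0` for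
all real `t ≥ 5`. -/
theorem chromatic_pos_planar_ge_five {V : Type} [Fintype V]
    (G : SimpleGraph V) (hplanar : G.IsPlanar)
    (P : Polynomial ℝ) (hP : G.IsChromaticPoly P)
    (t : ℝ) (ht : 5 ≤ t) :
    0 < P.eval t := by
  obtain ⟨Q, hQ, hQ'⟩ := G.polyValued_card_properColorings rfl hplanar.not_hasAlmostK5
  have hPQ : P = Q := by
    refine Polynomial.eq_of_infinite_eval_eq P Q ?_
    refine ((Set.Ioi_infinite (0 : ℕ)).image Nat.cast_injective.injOn).mono ?_
    rintro _ ⟨n, hn, rfl⟩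
    simp only [Set.mem_ofPred_eq, hP n hn, hQ n hn, SimpleGraph.card_properColorings]
  exact hPQ ▸ hQ' t ht
end
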